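/- Every finitely generated Sol-approximated group has a non-trivial abelian quotient; equivalently, if Γ is a finitely generated Sol-approximated group with Γ ≠ {1}, then the commutator subgroup [Γ,Γ] is a proper subgroup of Γ (so the abelianization Γ/[Γ,Γ] is non-trivial). In particular, a non-trivial finitely generated perfect group is not Sol-approximated. -/

import Mathlib

/-- A bi-invariant metric on a group `G`. -/
def IsBiInvMetric {G : Type*} [Group G] (d : G → G → ℝ) : Prop :=
  (∀ g h, d g h = 0 ↔ g = h) ∧
  (∀ g h, d g h = d h g) ∧
  (∀ g h k, d g k ≤ d g h + d h k) ∧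
  (∀ g h k, d (g * h) (g * k) = d h k) ∧
  (∀ g h k, d (h * g) (k * g) = d h k)

/-- `Γ` is approximated by the class of finite solvable groups equipped with
bi-invariant metrics. -/
def IsSolApproximated (Γ : Type*) [Group Γ] : Prop :=
  ∃ δ : Γ → ℝ, (∀ g : Γ, 0 ≤ δ g) ∧ (∀ g : Γ, g ≠ 1 → 0 < δ g) ∧
    ∀ (S : Finset Γ) (ε : ℝ), 0 < ε →
      ∃ (G : Type) (_ : Group G) (_ : Finite G) (_ : IsSolvable G)
        (d : G → G → ℝ) (φ : Γ → G),
        IsBiInvMetric d ∧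
        (∀ g h : Γ, g ∈ S → h ∈ S → g * h ∈ S → d (φ g * φ h) (φ (g * h)) < ε) ∧
        (∀ g ∈ S, δ g ≤ d 1 (φ g))

open scoped commutatorElement

theorem Subgroup.mem_of_eq {G : Type*} [Group G] {H : Subgroup G} {a b : G} (ha : a ∈ H)
    (hab : b = a) : b ∈ H :=
  hab ▸ ha

theorem exists_normal_commutator_le_not_le {G : Type*} [Group G] [Group.IsSolvable G]
    {N : Subgroup G} (hN : N ≠ ⊤) :
    ∃ D : Subgroup G, D.Normal ∧ ⁅D, D⁆ ≤ N ∧ ¬ D ≤ N := by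
  classical
  obtain ⟨n, hn⟩ := Group.IsSolvable.solvable (G := G)
  have hex : ∃ n, derivedSeries G n ≤ N := ⟨n, hn ▸ bot_le⟩
  have h0 : Nat.find hex ≠ 0 := by
    intro h
    have := Nat.find_spec hex
    rw [h, derivedSeries_zero, top_le_iff] at this
    exact hN this
  obtain ⟨k, hk⟩ := Nat.exists_eq_succ_of_ne_zero h0
  refine ⟨derivedSeries G k, derivedSeries_normal G k, ?_, Nat.find_min hex (by omega)⟩
  have := Nat.find_spec hex
  rwa [hk, derivedSeries_succ] at this

theorem exists_disjoint_translate {G : Type*} [Group G] [Group.IsSolvable G] {Q : Subgroup G}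
    (hQ : IsCoatom Q) {y : G} (hy : y ∉ Q.normalCore) :
    ∃ u : G, ∀ g : G, g⁻¹ * y * g ∈ Q → (u * g)⁻¹ * y * (u * g) ∉ Q := by
  by_cases hfix : ∃ g₀, g₀⁻¹ * y * g₀ ∈ Q
  swap
  · push Not at hfix
    exact ⟨1, fun g hg => (hfix g hg).elim⟩
  obtain ⟨g₀, hg₀⟩ := hfix
  obtain ⟨D, hD, hDD, hDN⟩ := exists_normal_commutator_le_not_le (N := Q.normalCore)
    (fun h => hQ.1 (top_le_iff.1 (h ▸ Q.normalCore_le)))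
  have hDQ : ¬ D ≤ Q := fun h => hDN (Subgroup.normal_le_normalCore.2 h)
  have htop : D ⊔ Q = ⊤ := by
    rw [sup_comm]
    exact hQ.2 _ (lt_of_le_of_ne le_sup_left fun h => hDQ (h ▸ le_sup_right))
  have hdec : ∀ g : G, ∃ d ∈ D, ∃ q ∈ Q, d * q = g := fun g =>
    Subgroup.mem_sup_of_normal_left.1 (htop ▸ Subgroup.mem_top g)
  have hnorm : (D ⊓ Q).Normal := by
    refine ⟨fun n hn g => ?_⟩
    obtain ⟨d, hd, q, hq, rfl⟩ := hdec g
    have hm : q * n * q⁻¹ ∈ D := hD.conj_mem _ hn.1 _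
    have hm' : q * n * q⁻¹ ∈ Q := Q.mul_mem (Q.mul_mem hq hn.2) (Q.inv_mem hq)
    refine ⟨hD.conj_mem _ hn.1 _, ?_⟩
    have h1 : ⁅d, q * n * q⁻¹⁆ ∈ Q :=
      Q.normalCore_le (hDD (Subgroup.commutator_mem_commutator hd hm))
    exact Subgroup.mem_of_eq (Q.mul_mem h1 hm') (by simp only [commutatorElement_def]; group)
  have hcore : D ⊓ Q ≤ Q.normalCore := Subgroup.normal_le_normalCore.2 inf_le_right
  set y' := g₀⁻¹ * y * g₀ with hy'
  have hy'core : y' ∉ Q.normalCore := by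
    intro h
    have := (Q.normalCore_normal).conj_mem _ h g₀
    rw [hy'] at this
    exact hy (by convert this using 1; group)
  obtain ⟨d₁, hd₁, hd₁Q⟩ : ∃ d ∈ D, d⁻¹ * y' * d ∉ Q := by
    by_contra! hcon
    refine hy'core fun g => ?_
    obtain ⟨d, hd, q, hq, hdq⟩ := hdec g⁻¹
    have := Q.mul_mem (Q.mul_mem (Q.inv_mem hq) (hcon d hd)) hq
    have hg : g = q⁻¹ * d⁻¹ := by rw [← mul_inv_rev, hdq, inv_inv]
    rw [hg]
    convert this using 1
    group
  have key : ∀ d ∈ D, d⁻¹ * y' * d ∈ Q → y'⁻¹ * d⁻¹ * y' * d ∈ Q.normalCore := by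
    intro d hd hdq
    refine hcore ⟨?_, ?_⟩
    · have h1 := D.mul_mem (hD.conj_mem _ (D.inv_mem hd) y'⁻¹) hd
      exact Subgroup.mem_of_eq h1 (by group)
    · have h1 := Q.mul_mem (Q.inv_mem hg₀) hdq
      exact Subgroup.mem_of_eq h1 (by group)
  refine ⟨g₀ * d₁ * g₀⁻¹, fun g hg hug => hd₁Q ?_⟩
  obtain ⟨d, hd, q, hq, hdq⟩ := hdec (g₀⁻¹ * g)
  have hg' : g = g₀ * d * q := by rw [mul_assoc, hdq]; group
  have h1 : d⁻¹ * y' * d ∈ Q := by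
    have := Q.mul_mem (Q.mul_mem hq hg) (Q.inv_mem hq)
    rw [hg'] at this
    convert this using 1
    rw [hy']; group
  have h2 : (d₁ * d)⁻¹ * y' * (d₁ * d) ∈ Q := by
    have := Q.mul_mem (Q.mul_mem hq hug) (Q.inv_mem hq)
    rw [hg'] at this
    convert this using 1
    rw [hy']; group
  have k1 := key d hd h1
  have k2 := key _ (D.mul_mem hd₁ hd) h2
  have k3 := Q.normalCore_normal.conj_mem _
    (Q.normalCore.mul_mem (Q.normalCore.inv_mem k1) k2) d
  have k4 : y'⁻¹ * d₁⁻¹ * y' * d₁ ∈ Q.normalCore := by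
    convert k3 using 1
    group
  have := Q.mul_mem hg₀ (Q.normalCore_le k4)
  convert this using 1
  group

theorem AddSubgroup.card_mul_card_le {V : Type*} [AddCommGroup V] [Finite V]
    (P Q : AddSubgroup V) :
    Nat.card P * Nat.card Q ≤ Nat.card V * Nat.card (P ⊓ Q : AddSubgroup V) := by
  have h1 := AddSubgroup.relIndex_mul_relIndex ⊥ (P ⊓ Q) Q bot_le inf_le_right
  rw [AddSubgroup.relIndex_bot_left, AddSubgroup.relIndex_bot_left,
    AddSubgroup.inf_relIndex_right] at h1
  have h2 : P.relIndex Q ≤ P.index :=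
    Nat.le_of_dvd (Nat.pos_of_ne_zero AddSubgroup.index_ne_zero_of_finite)
      (AddSubgroup.relIndex_dvd_index_of_normal P Q)
  calc Nat.card P * Nat.card Q = Nat.card (P ⊓ Q : AddSubgroup V) * (Nat.card P * P.relIndex Q) := by
        rw [← h1]; ring
    _ ≤ Nat.card (P ⊓ Q : AddSubgroup V) * (Nat.card P * P.index) := by gcongr
    _ = _ := by rw [AddSubgroup.card_mul_index, mul_comm]

theorem exists_isIdempotentElem_pow {M : Type*} [Monoid M] [Finite M] (b : M) :
    ∃ n, n ≠ 0 ∧ IsIdempotentElem (b ^ n) := by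
  obtain ⟨i, j, hij, hb⟩ : ∃ i j, i < j ∧ b ^ i = b ^ j := by
    obtain ⟨i, j, hne, hb⟩ := Finite.exists_ne_map_eq_of_infinite fun n : ℕ => b ^ n
    rcases hne.lt_or_gt with h | h
    exacts [⟨i, j, h, hb⟩, ⟨j, i, h, hb.symm⟩]
  obtain ⟨k, rfl⟩ := Nat.exists_eq_add_of_le hij.le
  have step : ∀ m n, i ≤ n → b ^ (n + k * m) = b ^ n := by
    intro m n hn
    induction m with
    | zero => simp
    | succ m ih =>
      obtain ⟨r, rfl⟩ := Nat.exists_eq_add_of_le hn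
      rw [show i + r + k * (m + 1) = (i + k) + (r + k * m) by ring, pow_add, ← hb, ← pow_add,
        ← add_assoc, ih]
  refine ⟨k * (i + 1), Nat.mul_ne_zero (by omega) (by omega), ?_⟩
  rw [IsIdempotentElem, ← pow_add]
  exact step _ _ (by nlinarith [show 1 ≤ k by omega])

/-- The subgroup of points fixed by an additive endomorphism. -/
def AddMonoid.End.fixed {V : Type*} [AddCommGroup V] (a : AddMonoid.End V) : AddSubgroup V where
  carrier := {v | a v = v}
  zero_mem' := map_zero a
  add_mem' {v w} (hv : a v = v) (hw : a w = w) := by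
    change a (v + w) = v + w
    rw [map_add, hv, hw]
  neg_mem' {v} (hv : a v = v) := by
    change a (-v) = -v
    rw [map_neg, hv]

theorem AddMonoid.End.mem_fixed {V : Type*} [AddCommGroup V] {a : AddMonoid.End V} {v : V} :
    v ∈ a.fixed ↔ a v = v :=
  Iff.rfl

/-- Every permutation moving at least half of a finite set displaces a sixth of it completely. -/
theorem Finset.exists_disjoint_image {α : Type*} [DecidableEq α] (Ω : Finset α) (σ : Equiv.Perm α)
    (hfix : 2 * (Ω.filter fun f => σ f = f).card ≤ Ω.card) :
    ∃ T ⊆ Ω, (∀ f ∈ T, σ f ∉ T) ∧ Ω.card ≤ 6 * T.card := by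
  obtain ⟨T, hT, hmax⟩ := Finset.exists_max_image
    (Ω.powerset.filter fun T => ∀ f ∈ T, σ f ∉ T) Finset.card ⟨∅, by simp⟩
  simp only [Finset.mem_filter, Finset.mem_powerset] at hT hmax
  refine ⟨T, hT.1, hT.2, ?_⟩
  have hcover : Ω ⊆ (Ω.filter fun f => σ f = f) ∪ (T ∪ (T.image σ ∪ T.image σ.symm)) := by
    intro f hf
    by_contra hcon
    simp only [Finset.mem_union, Finset.mem_filter, Finset.mem_image, not_or, not_and,
      not_exists] at hcon
    obtain ⟨h1, h2, h3, h4⟩ := hcon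
    have := hmax (insert f T) ⟨Finset.insert_subset hf hT.1, fun h hh hσ => ?_⟩
    · rw [Finset.card_insert_of_notMem h2] at this
      omega
    · rcases Finset.mem_insert.1 hh with rfl | hh
      · rcases Finset.mem_insert.1 hσ with hσ | hσ
        · exact h1 hf hσ
        · exact h4 _ hσ (σ.symm_apply_apply h)
      · rcases Finset.mem_insert.1 hσ with hσ | hσ
        · exact h3 h hh hσ
        · exact hT.2 h hh hσ
  have h1 := Finset.card_le_card hcover
  have h2 := Finset.card_union_le (Ω.filter fun f => σ f = f) (T ∪ (T.image σ ∪ T.image σ.symm))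
  have h3 := Finset.card_union_le T (T.image σ ∪ T.image σ.symm)
  have h4 := Finset.card_union_le (T.image σ) (T.image σ.symm)
  have h5 := Finset.card_image_le (s := T) (f := σ)
  have h6 := Finset.card_image_le (s := T) (f := σ.symm)
  omega

theorem AddMonoid.End.sum_apply {V ι : Type*} [AddCommGroup V] (s : Finset ι)
    (f : ι → AddMonoid.End V) (v : V) : (∑ i ∈ s, f i) v = ∑ i ∈ s, f i v :=
  map_sum (AddMonoidHom.eval v : (V →+ V) →+ V) f s

/-- An automorphism permuting a system of imprimitivity and moving at least half of its blocks has
few fixed points. -/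
theorem AddMonoid.End.card_fixed_pow_six_le {V : Type*} [AddCommGroup V] [Finite V]
    (Ω : Finset (AddMonoid.End V)) (r : ℕ) (hr : ∀ f ∈ Ω, Nat.card (AddMonoidHom.range f) = r)
    (hidem : ∀ f ∈ Ω, f * f = f) (horth : ∀ f ∈ Ω, ∀ f' ∈ Ω, f ≠ f' → f * f' = 0)
    (hsum : ∑ f ∈ Ω, f = 1) (σ : Equiv.Perm (AddMonoid.End V)) (a : AddMonoid.End V)
    (ha : Function.Injective a) (hσΩ : ∀ f ∈ Ω, σ f ∈ Ω) (hσa : ∀ f ∈ Ω, a * f = σ f * a)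
    [DecidableEq (AddMonoid.End V)]
    (hfix : 2 * (Ω.filter fun f => σ f = f).card ≤ Ω.card) :
    Nat.card a.fixed ^ 6 ≤ Nat.card V ^ 5 := by
  obtain ⟨T, hTΩ, hT, hcard⟩ := Ω.exists_disjoint_image σ hfix
  have hrange : ∀ f ∈ Ω, ∀ v ∈ AddMonoidHom.range f, f v = v := by
    rintro f hf _ ⟨v, rfl⟩
    exact DFunLike.congr_fun (hidem f hf) v
  have hzero : ∀ f ∈ Ω, ∀ f' ∈ Ω, f ≠ f' → ∀ v ∈ AddMonoidHom.range f', f v = 0 := by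
    rintro f hf f' hf' hne _ ⟨v, rfl⟩
    exact DFunLike.congr_fun (horth f hf f' hf' hne) v
  let Ψ : (∀ f : T, AddMonoidHom.range (f : AddMonoid.End V)) × a.fixed → V :=
    fun p => ∑ f, (p.1 f : V) + p.2
  have hker : ∀ (w : ∀ f : T, AddMonoidHom.range (f : AddMonoid.End V)) (c : V), a c = c →
      ∑ f, (w f : V) = c → ∀ f, (w f : V) = 0 := by
    intro w c hc hw f
    have hf := hTΩ f.2
    have h1 : (f : AddMonoid.End V) c = w f := by
      rw [← hw, map_sum, Finset.sum_eq_single f, hrange _ hf _ (w f).2]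
      · intro b _ hb
        exact hzero _ hf _ (hTΩ b.2) (fun h => hb (Subtype.ext h.symm)) _ (w b).2
      · simp
    have h2 : σ f c = 0 := by
      rw [← hw, map_sum]
      refine Finset.sum_eq_zero fun b _ => ?_
      refine hzero _ (hσΩ _ hf) _ (hTΩ b.2) (fun h => hT f f.2 ?_) _ (w b).2
      rw [h]
      exact b.2
    have h3 := DFunLike.congr_fun (hσa f hf) c
    change a ((f : AddMonoid.End V) c) = σ f (a c) at h3
    rw [hc, h2, h1] at h3
    exact ha (h3.trans (map_zero a).symm)
  have hΨ : Function.Injective Ψ := by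
    rintro ⟨w, c⟩ ⟨w', c'⟩ h
    change ∑ f, (w f : V) + (c : V) = ∑ f, (w' f : V) + (c' : V) at h
    have h1 : ∑ f : T, ((w f - w' f : AddMonoidHom.range (f : AddMonoid.End V)) : V) = c' - c := by
      simp only [AddSubgroup.coe_sub, Finset.sum_sub_distrib]
      rw [sub_eq_sub_iff_add_eq_add, h, add_comm]
    have h2 := hker (fun f => w f - w' f) _ (c' - c).2 h1
    have h3 : w = w' := funext fun f => Subtype.ext (by simpa [sub_eq_zero] using h2 f)
    subst h3
    exact Prod.ext rfl (Subtype.ext (add_left_cancel h))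
  have h1 := Nat.card_le_card_of_injective Ψ hΨ
  let Θ : V → ∀ f : Ω, AddMonoidHom.range (f : AddMonoid.End V) := fun v f => ⟨(f : AddMonoid.End V) v, v, rfl⟩
  have hΘ : Function.Injective Θ := by
    intro v w h
    have h2 : ∀ u : V, u = ∑ f : Ω, (f : AddMonoid.End V) u := by
      intro u
      have := DFunLike.congr_fun hsum u
      rw [AddMonoid.End.sum_apply, ← Finset.sum_coe_sort] at this
      exact this.symm
    rw [h2 v, h2 w]
    exact Finset.sum_congr rfl fun f _ => congrArg Subtype.val (congrFun h f)
  have h2 := Nat.card_le_card_of_injective Θ hΘ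
  rw [Nat.card_prod, Nat.card_pi, Finset.prod_congr rfl fun f _ => hr _ (hTΩ f.2),
    Finset.prod_const, Finset.card_univ, Fintype.card_coe] at h1
  rw [Nat.card_pi, Finset.prod_congr rfl fun f _ => hr _ f.2, Finset.prod_const,
    Finset.card_univ, Fintype.card_coe] at h2
  have hV : 0 < Nat.card V := Nat.card_pos
  have hr1 : 1 ≤ r ∨ Ω.card = 0 := by
    rcases Ω.eq_empty_or_nonempty with h | ⟨f, hf⟩
    · exact Or.inr (by simp [h])
    · exact Or.inl (hr f hf ▸ Nat.card_pos)
  have h3 : Nat.card V ≤ (r ^ T.card) ^ 6 := by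
    rcases hr1 with hr1 | h0
    · refine h2.trans ?_
      rw [← pow_mul]
      exact Nat.pow_le_pow_right hr1 (by omega)
    · rw [h0, pow_zero] at h2
      refine h2.trans (Nat.one_le_pow _ _ ?_)
      rcases Nat.eq_zero_or_pos r with rfl | h
      · have := Finset.card_le_card hTΩ
        simp [show T.card = 0 by omega]
      · positivity
  refine Nat.le_of_mul_le_mul_left ?_ hV
  calc Nat.card V * Nat.card a.fixed ^ 6 ≤ (r ^ T.card) ^ 6 * Nat.card a.fixed ^ 6 := by gcongr
    _ = (r ^ T.card * Nat.card a.fixed) ^ 6 := by rw [mul_pow]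
    _ ≤ Nat.card V ^ 6 := by gcongr
    _ = _ := by ring

/-- The elements commuting with `A` modulo the normal subgroup `I`. -/
def Subgroup.centralizerMod {G : Type*} [Group G] (A I : Subgroup G) [hI : I.Normal] :
    Subgroup G where
  carrier := {g | ∀ a ∈ A, ⁅a, g⁆ ∈ I}
  one_mem' a _ := by simp
  mul_mem' {g h} hg hh a ha :=
    mem_of_eq (I.mul_mem (hg a ha) (hI.conj_mem _ (hh a ha) g))
      (by simp only [commutatorElement_def]; group)
  inv_mem' {g} hg a ha :=
    mem_of_eq (hI.conj_mem _ (I.inv_mem (hg a ha)) g⁻¹)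
      (by simp only [commutatorElement_def]; group)

instance Subgroup.centralizerMod_normal {G : Type*} [Group G] (A I : Subgroup G) [hA : A.Normal]
    [hI : I.Normal] : (A.centralizerMod I).Normal where
  conj_mem x hx g a ha :=
    mem_of_eq (hI.conj_mem _ (hx _ (hA.conj_mem _ ha g⁻¹)) g)
      (by simp only [commutatorElement_def]; group)

theorem Subgroup.exists_commutator_notMem {G : Type*} [Group G] {A I : Subgroup G} [A.Normal]
    [I.Normal] {S : Set G} (hS : Subgroup.normalClosure S = ⊤) (hAI : ¬ ⁅A, (⊤ : Subgroup G)⁆ ≤ I) :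
    ∃ y ∈ S, ∃ a ∈ A, ⁅a, y⁆ ∉ I := by
  by_contra! h
  refine hAI (Subgroup.commutator_le.2 fun a ha g _ => ?_)
  have h1 : Subgroup.normalClosure S ≤ A.centralizerMod I :=
    Subgroup.normalClosure_le_normal fun y hy a ha => h y hy a ha
  exact h1 (hS ▸ Subgroup.mem_top g) a ha

section Representation

variable {G V : Type*} [Group G] [AddCommGroup V]

theorem map_apply_map_inv_apply (ρ : G →* AddMonoid.End V) (g : G) (v : V) :
    ρ g (ρ g⁻¹ v) = v := by
  have := DFunLike.congr_fun (map_mul ρ g g⁻¹) v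
  rw [mul_inv_cancel, map_one] at this
  exact this.symm

theorem map_inv_apply_map_apply (ρ : G →* AddMonoid.End V) (g : G) (v : V) :
    ρ g⁻¹ (ρ g v) = v := by
  simpa using map_apply_map_inv_apply ρ g⁻¹ v

theorem fixed_eq_bot_of_mem_center {ρ : G →* AddMonoid.End V} (hρ : Function.Injective ρ)
    (hirr : ∀ W : AddSubgroup V, (∀ g, ∀ w ∈ W, ρ g w ∈ W) → W = ⊥ ∨ W = ⊤)
    {z : G} (hz : z ∈ Subgroup.center G) (hz1 : z ≠ 1) : (ρ z).fixed = ⊥ := by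
  refine (hirr _ fun g w hw => ?_).resolve_right fun h => hz1 (hρ ?_)
  · rw [AddMonoid.End.mem_fixed] at hw ⊢
    have := DFunLike.congr_fun (congrArg ρ (Subgroup.mem_center_iff.1 hz g)) w
    rw [map_mul, map_mul] at this
    change ρ g (ρ z w) = ρ z (ρ g w) at this
    rw [← this, hw]
  · rw [map_one]
    ext v
    exact AddMonoid.End.mem_fixed.1 (h ▸ AddSubgroup.mem_top v)

theorem card_fixed_sq_le [Finite V] (ρ : G →* AddMonoid.End V) (b y : G) :
    Nat.card (ρ y).fixed ^ 2 ≤ Nat.card V * Nat.card (ρ ⁅b, y⁆).fixed := by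
  have h1 : Nat.card (ρ y).fixed ≤ Nat.card (ρ (b * y * b⁻¹)).fixed := by
    refine Nat.card_le_card_of_injective (fun v => ⟨ρ b v, ?_⟩) fun v w h => ?_
    · rw [AddMonoid.End.mem_fixed, map_mul, map_mul]
      change ρ b (ρ y (ρ b⁻¹ (ρ b v))) = ρ b v
      rw [map_inv_apply_map_apply, AddMonoid.End.mem_fixed.1 v.2]
    · have := congrArg (ρ b⁻¹) (congrArg Subtype.val h)
      simp only [map_inv_apply_map_apply] at this
      exact Subtype.ext this
  have h2 : (ρ y).fixed ⊓ (ρ (b * y * b⁻¹)).fixed ≤ (ρ ⁅b, y⁆).fixed := by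
    intro v hv
    have hy := AddMonoid.End.mem_fixed.1 hv.1
    have hb := AddMonoid.End.mem_fixed.1 hv.2
    rw [AddMonoid.End.mem_fixed, commutatorElement_def, map_mul]
    change ρ (b * y * b⁻¹) (ρ y⁻¹ v) = v
    have : ρ y⁻¹ v = v := by
      conv_lhs => rw [← hy]
      exact map_inv_apply_map_apply ρ y v
    rw [this, hb]
  calc Nat.card (ρ y).fixed ^ 2
      ≤ Nat.card (ρ y).fixed * Nat.card (ρ (b * y * b⁻¹)).fixed := by rw [sq]; gcongr
    _ ≤ _ := AddSubgroup.card_mul_card_le _ _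
    _ ≤ _ := by
      gcongr
      exact Nat.card_le_card_of_injective _ (AddSubgroup.inclusion_injective h2)

theorem card_fixed_pow_six_le_of_commutator [Finite V] {ρ : G →* AddMonoid.End V} {y c : G}
    (b : G) (hc : c = ⁅b, y⁆) (h : Nat.card (ρ c).fixed ^ 2 ≤ Nat.card V) :
    Nat.card (ρ y).fixed ^ 6 ≤ Nat.card V ^ 5 := by
  have h1 := card_fixed_sq_le ρ b y
  rw [← hc] at h1
  have h2 : Nat.card (ρ c).fixed ≤ Nat.card V := Nat.card_le_card_of_injective _ Subtype.val_injective
  calc Nat.card (ρ y).fixed ^ 6 = (Nat.card (ρ y).fixed ^ 2) ^ 3 := by ring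
    _ ≤ (Nat.card V * Nat.card (ρ c).fixed) ^ 3 := by gcongr
    _ = Nat.card V ^ 3 * Nat.card (ρ c).fixed ^ 2 * Nat.card (ρ c).fixed := by ring
    _ ≤ Nat.card V ^ 3 * Nat.card V * Nat.card V := by gcongr
    _ = _ := by ring

theorem card_fixed_sq_le_of_fixed_eq_bot [Finite V] {ρ : G →* AddMonoid.End V} {y : G} (b : G)
    (h : (ρ ⁅b, y⁆).fixed = ⊥) : Nat.card (ρ y).fixed ^ 2 ≤ Nat.card V := by
  simpa [h] using card_fixed_sq_le ρ b y

theorem exists_card_fixed_le_of_noncomm [Finite G] [Group.IsSolvable G] [Finite V]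
    {ρ : G →* AddMonoid.End V} (hρ : Function.Injective ρ)
    (hirr : ∀ W : AddSubgroup V, (∀ g, ∀ w ∈ W, ρ g w ∈ W) → W = ⊥ ∨ W = ⊤)
    {S : Set G} (hS : Subgroup.normalClosure S = ⊤) {A : Subgroup G} [hA : A.Normal]
    (hAc : ¬ A ≤ Subgroup.center G)
    (hmin : ∀ X : Subgroup G, X.Normal → X ≤ A → X ≤ Subgroup.center G ∨ X = A)
    (hcomm : ¬ ∀ a ∈ A, ∀ b ∈ A, ⁅a, b⁆ = 1) :
    ∃ y ∈ S, Nat.card (ρ y).fixed ^ 6 ≤ Nat.card V ^ 5 := by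
  have hAA : ⁅A, A⁆ ≤ Subgroup.center G := by
    refine (hmin _ inferInstance (Subgroup.commutator_le_left A A)).resolve_right fun h => ?_
    exact (Group.IsSolvable.commutator_lt_of_ne_bot (fun h' => hAc (h'.le.trans bot_le))).ne h
  have hAG : ¬ ⁅A, (⊤ : Subgroup G)⁆ ≤ Subgroup.center G := by
    intro h
    have h' : ∀ a ∈ A, ∀ g, ⁅a, g⁆ ∈ Subgroup.center G := fun a ha g =>
      h (Subgroup.commutator_mem_commutator ha (Subgroup.mem_top g))
    refine hcomm fun a ha b hb => ?_
    by_cases hac : a ∈ Subgroup.center G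
    · exact commutatorElement_eq_one_iff_mul_comm.2 (Subgroup.mem_center_iff.1 hac b).symm
    let X := A ⊓ Subgroup.centralizer {a}
    have hX : X.Normal := by
      refine ⟨fun x hx g => ⟨hA.conj_mem _ hx.1 g, ?_⟩⟩
      have h1 : ⁅g, x⁆ ∈ Subgroup.center G :=
        Subgroup.mem_of_eq ((Subgroup.center G).inv_mem (h' x hx.1 g)) (commutatorElement_inv _ _).symm
      exact Subgroup.mem_of_eq
        (Subgroup.mul_mem _ (Subgroup.center_le_centralizer {a} h1) hx.2)
        (by simp only [commutatorElement_def]; group)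
    have haX : a ∈ X := ⟨ha, by simp [Subgroup.mem_centralizer_iff]⟩
    have hXA := (hmin X hX inf_le_left).resolve_left fun h => hac (h haX)
    have hbX : b ∈ X := hXA ▸ hb
    exact commutatorElement_eq_one_iff_mul_comm.2 (Subgroup.mem_centralizer_iff.1 hbX.2 a rfl)
  obtain ⟨y, hy, a, ha, hc⟩ := Subgroup.exists_commutator_notMem hS hAG
  have hcA : ⁅a, y⁆ ∈ A := Subgroup.commutator_le_left A ⊤
    (Subgroup.commutator_mem_commutator ha (Subgroup.mem_top y))
  obtain ⟨b, hb, hbc⟩ : ∃ b ∈ A, ⁅b, ⁅a, y⁆⁆ ≠ 1 := by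
    by_contra! hcon
    have hX : (A ⊓ Subgroup.centralizer (A : Set G)).Normal := inferInstance
    have hcX : ⁅a, y⁆ ∈ A ⊓ Subgroup.centralizer (A : Set G) :=
      ⟨hcA, Subgroup.mem_centralizer_iff.2 fun b hb =>
        commutatorElement_eq_one_iff_mul_comm.1 (hcon b hb)⟩
    rcases hmin _ hX inf_le_left with h | h
    · exact hc (h hcX)
    · refine hcomm fun a ha b hb => ?_
      rw [← h] at hb
      exact commutatorElement_eq_one_iff_mul_comm.2 (Subgroup.mem_centralizer_iff.1 hb.2 a ha)
  refine ⟨y, hy, card_fixed_pow_six_le_of_commutator a rfl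
    (card_fixed_sq_le_of_fixed_eq_bot b (fixed_eq_bot_of_mem_center hρ hirr ?_ hbc))⟩
  exact hAA (Subgroup.commutator_mem_commutator hb hcA)

end Representation

theorem AddMonoid.End.eq_of_mul_eq_of_card_le {V : Type*} [AddCommGroup V] [Finite V]
    {e f : AddMonoid.End V} (hf : f * f = f) (hef : e * f = f) (hfe : f * e = f)
    (hcard : Nat.card (AddMonoidHom.range e) ≤ Nat.card (AddMonoidHom.range f)) : f = e := by
  have h1 : AddMonoidHom.range f ≤ AddMonoidHom.range e := by
    rintro _ ⟨v, rfl⟩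
    exact ⟨f v, DFunLike.congr_fun hef v⟩
  have h2 := AddSubgroup.eq_of_le_of_card_ge h1 hcard
  ext v
  obtain ⟨w, hw⟩ : e v ∈ AddMonoidHom.range f := h2 ▸ ⟨v, rfl⟩
  have h3 : f (e v) = f v := DFunLike.congr_fun hfe v
  rw [← h3, ← hw]
  exact DFunLike.congr_fun hf w

theorem exists_ne_zero_forall_nilpotent {V : Type*} [AddCommGroup V] [Nontrivial V]
    (F : Finset (AddMonoid.End V)) (hnil : ∀ x ∈ F, IsNilpotent x)
    (hcomm : ∀ x ∈ F, ∀ y ∈ F, x * y = y * x) : ∃ v : V, v ≠ 0 ∧ ∀ x ∈ F, x v = 0 := by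
  classical
  induction F using Finset.induction_on with
  | empty => simpa using exists_ne (0 : V)
  | insert x F _ ih =>
    obtain ⟨v, hv, hF⟩ := ih (fun x hx => hnil x (Finset.mem_insert_of_mem hx))
      fun x hx y hy => hcomm x (Finset.mem_insert_of_mem hx) y (Finset.mem_insert_of_mem hy)
    have hex : ∃ k, (x ^ k) v = 0 := by
      obtain ⟨k, hk⟩ := hnil x (Finset.mem_insert_self _ _)
      exact ⟨k, by rw [hk]; rfl⟩
    have h0 : Nat.find hex ≠ 0 := fun h => hv (by
      have := Nat.find_spec hex
      rwa [h, pow_zero] at this)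
    obtain ⟨k, hk⟩ := Nat.exists_eq_succ_of_ne_zero h0
    refine ⟨(x ^ k) v, Nat.find_min hex (by omega), fun y hy => ?_⟩
    rcases Finset.mem_insert.1 hy with rfl | hyF
    · have := Nat.find_spec hex
      rwa [hk, Nat.succ_eq_add_one, pow_succ'] at this
    · have h1 : Commute y (x ^ k) :=
        Commute.pow_right (hcomm y hy x (Finset.mem_insert_self _ _)) k
      have := DFunLike.congr_fun h1.eq v
      change y ((x ^ k) v) = (x ^ k) (y v) at this
      rw [this, hF y hyF, map_zero]

section Representation

variable {G V : Type*} [Group G] [AddCommGroup V]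

/-- The conjugation action on the endomorphism ring of a representation. -/
def endConj (ρ : G →* AddMonoid.End V) : G →* Equiv.Perm (AddMonoid.End V) where
  toFun g :=
    { toFun := fun f => ρ g * f * ρ g⁻¹
      invFun := fun f => ρ g⁻¹ * f * ρ g
      left_inv := fun f => by
        ext v
        change ρ g⁻¹ (ρ g (f (ρ g⁻¹ (ρ g v)))) = f v
        simp only [map_inv_apply_map_apply]
      right_inv := fun f => by
        ext v
        change ρ g (ρ g⁻¹ (f (ρ g (ρ g⁻¹ v)))) = f v
        simp only [map_apply_map_inv_apply] }
  map_one' := by ext f v; simp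
  map_mul' g h := by
    ext f v
    simp [mul_assoc]

theorem endConj_apply (ρ : G →* AddMonoid.End V) (g : G) (f : AddMonoid.End V) :
    endConj ρ g f = ρ g * f * ρ g⁻¹ :=
  rfl

theorem map_inv_mul_map (ρ : G →* AddMonoid.End V) (g : G) : ρ g⁻¹ * ρ g = 1 := by
  rw [← map_mul, inv_mul_cancel, map_one]

theorem endConj_mul (ρ : G →* AddMonoid.End V) (g : G) (f f' : AddMonoid.End V) :
    endConj ρ g (f * f') = endConj ρ g f * endConj ρ g f' := by
  simp only [endConj_apply]
  calc ρ g * (f * f') * ρ g⁻¹ = ρ g * f * 1 * (f' * ρ g⁻¹) := by simp only [mul_assoc, mul_one]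
    _ = _ := by rw [← map_inv_mul_map ρ g]; simp only [mul_assoc]

theorem mul_eq_endConj_mul (ρ : G →* AddMonoid.End V) (g : G) (f : AddMonoid.End V) :
    ρ g * f = endConj ρ g f * ρ g := by
  rw [endConj_apply, mul_assoc, map_inv_mul_map, mul_one]

theorem endConj_zero (ρ : G →* AddMonoid.End V) (g : G) : endConj ρ g 0 = 0 := by
  simp [endConj_apply]

theorem card_range_endConj [Finite V] (ρ : G →* AddMonoid.End V) (g : G) (f : AddMonoid.End V) :
    Nat.card (AddMonoidHom.range (endConj ρ g f)) = Nat.card (AddMonoidHom.range f) := by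
  have key : ∀ (g : G) (f : AddMonoid.End V),
      Nat.card (AddMonoidHom.range f) ≤ Nat.card (AddMonoidHom.range (endConj ρ g f)) := by
    intro g f
    refine Nat.card_le_card_of_injective (fun v => ⟨ρ g v, ?_⟩) fun v w h => ?_
    · obtain ⟨_, v, rfl⟩ := v
      refine ⟨ρ g v, ?_⟩
      change ρ g (f (ρ g⁻¹ (ρ g v))) = ρ g (f v)
      rw [map_inv_apply_map_apply]
    · have := congrArg (ρ g⁻¹) (congrArg Subtype.val h)
      simp only [map_inv_apply_map_apply] at this
      exact Subtype.ext this
  refine le_antisymm ?_ (key g f)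
  have := key g⁻¹ (endConj ρ g f)
  rwa [← Equiv.Perm.mul_apply, ← map_mul, inv_mul_cancel, map_one, Equiv.Perm.one_apply] at this

/-- The double centralizer of the image of `A`. -/
def doubleCentralizer (ρ : G →* AddMonoid.End V) (A : Subgroup G) : Subring (AddMonoid.End V) :=
  Subring.centralizer (Set.centralizer (ρ '' (A : Set G)))

theorem map_mem_doubleCentralizer (ρ : G →* AddMonoid.End V) {A : Subgroup G} {a : G}
    (ha : a ∈ A) : ρ a ∈ doubleCentralizer ρ A :=
  Set.subset_centralizer_centralizer ⟨a, ha, rfl⟩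

theorem doubleCentralizer_comm (ρ : G →* AddMonoid.End V) {A : Subgroup G}
    (hA : ∀ a ∈ A, ∀ b ∈ A, ⁅a, b⁆ = 1) {x y : AddMonoid.End V} (hx : x ∈ doubleCentralizer ρ A)
    (hy : y ∈ doubleCentralizer ρ A) : x * y = y * x := by
  have h1 : ρ '' (A : Set G) ⊆ Set.centralizer (ρ '' (A : Set G)) := by
    rintro _ ⟨a, ha, rfl⟩ _ ⟨b, hb, rfl⟩
    rw [← map_mul, ← map_mul, commutatorElement_eq_one_iff_mul_comm.1 (hA b hb a ha)]
  have h2 : x ∈ Set.centralizer (ρ '' (A : Set G)) := fun z hz => hx z (h1 hz)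
  exact hy x h2

theorem endConj_mem_doubleCentralizer (ρ : G →* AddMonoid.End V) {A : Subgroup G} [hA : A.Normal]
    (g : G) {x : AddMonoid.End V} (hx : x ∈ doubleCentralizer ρ A) :
    endConj ρ g x ∈ doubleCentralizer ρ A := by
  have h1 : ∀ z ∈ Set.centralizer (ρ '' (A : Set G)),
      endConj ρ g⁻¹ z ∈ Set.centralizer (ρ '' (A : Set G)) := by
    rintro z hz _ ⟨a, ha, rfl⟩
    have h2 := hz _ ⟨_, hA.conj_mem _ ha g, rfl⟩
    have h3 : endConj ρ g⁻¹ (ρ (g * a * g⁻¹)) = ρ a := by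
      rw [endConj_apply, ← map_mul, ← map_mul]
      congr 1
      group
    rw [← h3, ← endConj_mul, h2, endConj_mul]
  intro z hz
  have h2 := hx _ (h1 z hz)
  have h3 : endConj ρ g (endConj ρ g⁻¹ z) = z := by
    rw [← Equiv.Perm.mul_apply, ← map_mul, mul_inv_cancel, map_one, Equiv.Perm.one_apply]
  rw [← h3, ← endConj_mul, h2, endConj_mul]

theorem exists_card_fixed_le_of_comm [Finite G] [Group.IsSolvable G] [Finite V] [Nontrivial V]
    {ρ : G →* AddMonoid.End V} (hρ : Function.Injective ρ)
    (hirr : ∀ W : AddSubgroup V, (∀ g, ∀ w ∈ W, ρ g w ∈ W) → W = ⊥ ∨ W = ⊤)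
    {S : Set G} (hS : Subgroup.normalClosure S = ⊤) {A : Subgroup G} [hA : A.Normal]
    (hAc : ¬ A ≤ Subgroup.center G) (hcomm : ∀ a ∈ A, ∀ b ∈ A, ⁅a, b⁆ = 1) :
    ∃ y ∈ S, Nat.card (ρ y).fixed ^ 6 ≤ Nat.card V ^ 5 := by
  classical
  have : Finite (AddMonoid.End V) := DFunLike.finite _
  have : Fintype G := Fintype.ofFinite G
  let B := doubleCentralizer ρ A
  have h10 : (1 : AddMonoid.End V) ≠ 0 := fun h => by
    obtain ⟨v, hv⟩ := exists_ne (0 : V)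
    exact hv (DFunLike.congr_fun h v)
  obtain ⟨e, ⟨heB, he, he0⟩, hemin⟩ := Set.exists_min_image
    {e : AddMonoid.End V | e ∈ B ∧ e * e = e ∧ e ≠ 0}
    (fun e => Nat.card (AddMonoidHom.range e)) (Set.toFinite _) ⟨1, B.one_mem, one_mul 1, h10⟩
  have hmul : ∀ g, ∀ f ∈ B, f * f = f → f * endConj ρ g e = 0 ∨ f * endConj ρ g e = endConj ρ g e := by
    intro g f hf hff
    have hgB : endConj ρ g e ∈ B := endConj_mem_doubleCentralizer ρ g heB
    have hge : endConj ρ g e * endConj ρ g e = endConj ρ g e := by rw [← endConj_mul, he]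
    have hc := doubleCentralizer_comm ρ hcomm hf hgB
    by_cases h0 : f * endConj ρ g e = 0
    · exact Or.inl h0
    refine Or.inr (AddMonoid.End.eq_of_mul_eq_of_card_le ?_ ?_ ?_ ?_)
    · calc f * endConj ρ g e * (f * endConj ρ g e)
          = f * (endConj ρ g e * f) * endConj ρ g e := by simp only [mul_assoc]
        _ = (f * f) * (endConj ρ g e * endConj ρ g e) := by rw [← hc]; simp only [mul_assoc]
        _ = _ := by rw [hff, hge]
    · rw [hc, ← mul_assoc, hge]
    · rw [mul_assoc, hge]
    · rw [card_range_endConj]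
      refine hemin _ ⟨B.mul_mem hf hgB, ?_, h0⟩
      calc f * endConj ρ g e * (f * endConj ρ g e)
          = f * (endConj ρ g e * f) * endConj ρ g e := by simp only [mul_assoc]
        _ = (f * f) * (endConj ρ g e * endConj ρ g e) := by rw [← hc]; simp only [mul_assoc]
        _ = _ := by rw [hff, hge]
  let Ω : Finset (AddMonoid.End V) := Finset.univ.image fun g => endConj ρ g e
  have hmemΩ : ∀ f, f ∈ Ω ↔ ∃ g, endConj ρ g e = f := fun f => by simp [Ω]
  have hΩconj : ∀ g, ∀ f ∈ Ω, endConj ρ g f ∈ Ω := by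
    intro g f hf
    obtain ⟨h, rfl⟩ := (hmemΩ f).1 hf
    exact (hmemΩ _).2 ⟨g * h, by rw [map_mul]; rfl⟩
  have heΩ : e ∈ Ω := (hmemΩ e).2 ⟨1, by simp⟩
  have hidem : ∀ f ∈ Ω, f * f = f := by
    intro f hf
    obtain ⟨g, rfl⟩ := (hmemΩ f).1 hf
    rw [← endConj_mul, he]
  have hΩB : ∀ f ∈ Ω, f ∈ B := by
    intro f hf
    obtain ⟨g, rfl⟩ := (hmemΩ f).1 hf
    exact endConj_mem_doubleCentralizer ρ g heB
  have horth : ∀ f ∈ Ω, ∀ f' ∈ Ω, f ≠ f' → f * f' = 0 := by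
    intro f hf f' hf' hne
    obtain ⟨g, rfl⟩ := (hmemΩ f).1 hf
    obtain ⟨g', rfl⟩ := (hmemΩ f').1 hf'
    refine (hmul g' _ (hΩB _ hf) (hidem _ hf)).resolve_right fun h => ?_
    have hc := doubleCentralizer_comm ρ hcomm (hΩB _ hf) (hΩB _ hf')
    rcases hmul g _ (hΩB _ hf') (hidem _ hf') with h' | h'
    · rw [← hc, h] at h'
      have := congrArg (endConj ρ g'⁻¹) h'
      rw [← Equiv.Perm.mul_apply, ← map_mul, inv_mul_cancel, map_one, Equiv.Perm.one_apply,
        endConj_zero] at this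
      exact he0 this
    · exact hne (by rw [← h', ← hc, h])
  have hsumconj : ∀ g, endConj ρ g (∑ f ∈ Ω, f) = ∑ f ∈ Ω, f := by
    intro g
    calc endConj ρ g (∑ f ∈ Ω, f) = ∑ f ∈ Ω, endConj ρ g f := by
          simp only [endConj_apply, Finset.mul_sum, Finset.sum_mul]
      _ = ∑ f ∈ Ω, f := Finset.sum_bijective (endConj ρ g) (endConj ρ g).bijective (fun f => by
          refine ⟨hΩconj g f, fun h => ?_⟩
          have := hΩconj g⁻¹ _ h
          rwa [← Equiv.Perm.mul_apply, ← map_mul, inv_mul_cancel, map_one,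
            Equiv.Perm.one_apply] at this) fun _ _ => rfl
  have hse : (∑ f ∈ Ω, f) * e = e := by
    rw [Finset.sum_mul, Finset.sum_eq_single e (fun f hf hne => horth f hf e heΩ hne)
      (fun h => (h heΩ).elim), he]
  have hsum : ∑ f ∈ Ω, f = 1 := by
    rcases hirr (∑ f ∈ Ω, f : AddMonoid.End V).fixed (fun g w hw => by
      rw [AddMonoid.End.mem_fixed] at hw ⊢
      have := DFunLike.congr_fun (mul_eq_endConj_mul ρ g (∑ f ∈ Ω, f)) w
      rw [hsumconj] at this
      change ρ g ((∑ f ∈ Ω, f : AddMonoid.End V) w) = (∑ f ∈ Ω, f : AddMonoid.End V) (ρ g w) at this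
      rw [← this, hw]) with h | h
    · refine (he0 ?_).elim
      ext v
      have h1 : e v ∈ (∑ f ∈ Ω, f : AddMonoid.End V).fixed := DFunLike.congr_fun hse v
      rwa [h] at h1
    · ext v
      exact AddMonoid.End.mem_fixed.1 (h ▸ AddSubgroup.mem_top v)
  by_cases hfixe : ∀ g, endConj ρ g e = e
  · have he1 : e = 1 := by
      have : Ω = {e} := by
        ext f
        rw [hmemΩ, Finset.mem_singleton]
        exact ⟨fun ⟨g, hg⟩ => by rw [← hg, hfixe], fun h => ⟨1, by rw [h, hfixe]⟩⟩
      rwa [this, Finset.sum_singleton] at hsum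
    have hAG : ¬ ⁅A, (⊤ : Subgroup G)⁆ ≤ ⊥ := fun h => hAc fun a ha =>
      Subgroup.mem_center_iff.2 fun g => (commutatorElement_eq_one_iff_mul_comm.1
        (Subgroup.mem_bot.1 (h (Subgroup.commutator_mem_commutator ha (Subgroup.mem_top g))))).symm
    obtain ⟨y, hy, a, ha, hc⟩ := Subgroup.exists_commutator_notMem hS hAG
    have hcA : ⁅a, y⁆ ∈ A := Subgroup.commutator_le_left A ⊤
      (Subgroup.commutator_mem_commutator ha (Subgroup.mem_top y))
    have hcB : ρ ⁅a, y⁆ - 1 ∈ B := B.sub_mem (map_mem_doubleCentralizer ρ hcA) B.one_mem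
    obtain ⟨n, hn, hid⟩ := exists_isIdempotentElem_pow (ρ ⁅a, y⁆ - 1)
    rcases hmul 1 _ (B.pow_mem hcB n) hid with h | h
    · rw [map_one, Equiv.Perm.one_apply, he1, mul_one] at h
      exfalso
      let U : AddSubgroup V :=
        ⨅ x : {x : AddMonoid.End V // x ∈ B ∧ IsNilpotent x}, AddMonoidHom.ker x.1
      have hU : ∀ v, v ∈ U ↔ ∀ x ∈ B, IsNilpotent x → x v = 0 := by
        intro v
        simp only [U, AddSubgroup.mem_iInf, Subtype.forall, and_imp]
        rfl
      rcases hirr U (fun g w hw => by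
        rw [hU] at hw ⊢
        intro x hx hnx
        have h1 := mul_eq_endConj_mul ρ g (endConj ρ g⁻¹ x)
        rw [← Equiv.Perm.mul_apply, ← map_mul, mul_inv_cancel, map_one, Equiv.Perm.one_apply] at h1
        have h2 : x (ρ g w) = ρ g (endConj ρ g⁻¹ x w) := (DFunLike.congr_fun h1 w).symm
        rw [h2, hw _ (endConj_mem_doubleCentralizer ρ _ hx) ?_, map_zero]
        obtain ⟨k, hk⟩ := hnx
        refine ⟨k, ?_⟩
        have h3 : ∀ k, endConj ρ g⁻¹ x ^ k = endConj ρ g⁻¹ (x ^ k) := by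
          intro k
          induction k with
          | zero => rw [pow_zero, pow_zero, endConj_apply, mul_one, ← map_mul]; simp
          | succ k ih => rw [pow_succ, pow_succ, endConj_mul, ih]
        rw [h3, hk, endConj_zero]) with hU' | hU'
      · obtain ⟨v, hv, hv'⟩ := exists_ne_zero_forall_nilpotent
          (Set.toFinite {x : AddMonoid.End V | x ∈ B ∧ IsNilpotent x}).toFinset
          (fun x hx => ((Set.Finite.mem_toFinset _).1 hx).2)
          (fun x hx x' hx' => doubleCentralizer_comm ρ hcomm ((Set.Finite.mem_toFinset _).1 hx).1
            ((Set.Finite.mem_toFinset _).1 hx').1)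
        have : v ∈ U := (hU v).2 fun x hx hx' =>
          hv' x ((Set.Finite.mem_toFinset _).2 ⟨hx, hx'⟩)
        rw [hU'] at this
        exact hv this
      · refine hc (Subgroup.mem_bot.2 (hρ ?_))
        rw [map_one, ← sub_eq_zero]
        ext v
        exact (hU v).1 (hU' ▸ AddSubgroup.mem_top v) _ hcB ⟨n, h⟩
    · rw [map_one, Equiv.Perm.one_apply, he1, mul_one] at h
      refine ⟨y, hy, ?_⟩
      have h1 : (ρ ⁅a, y⁆).fixed = ⊥ := by
        rw [eq_bot_iff]
        intro v hv
        have h2 : (ρ ⁅a, y⁆ - 1) v = 0 := by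
          change ρ ⁅a, y⁆ v - v = 0
          rw [AddMonoid.End.mem_fixed.1 hv, sub_self]
        obtain ⟨k, rfl⟩ := Nat.exists_eq_succ_of_ne_zero hn
        have h3 := DFunLike.congr_fun h v
        rw [Nat.succ_eq_add_one, pow_succ] at h3
        change ((ρ ⁅a, y⁆ - 1) ^ k) ((ρ ⁅a, y⁆ - 1) v) = v at h3
        rw [h2, map_zero] at h3
        exact h3.symm
      have h2 := card_fixed_sq_le_of_fixed_eq_bot a h1
      have hV : 1 ≤ Nat.card V := Nat.card_pos
      calc Nat.card (ρ y).fixed ^ 6 = (Nat.card (ρ y).fixed ^ 2) ^ 3 := by ring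
        _ ≤ Nat.card V ^ 3 := by gcongr
        _ ≤ _ := Nat.pow_le_pow_right hV (by norm_num)
  · let H : Subgroup G :=
      { carrier := {g | endConj ρ g e = e}
        one_mem' := by simp
        mul_mem' := fun {g h} (hg : _ = e) (hh : _ = e) => by
          change endConj ρ (g * h) e = e
          rw [map_mul, Equiv.Perm.mul_apply, hh, hg]
        inv_mem' := fun {g} (hg : _ = e) => by
          change endConj ρ g⁻¹ e = e
          rw [map_inv, Equiv.Perm.inv_eq_iff_eq, hg] }
    have hH : ∀ g, g ∈ H ↔ endConj ρ g e = e := fun _ => Iff.rfl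
    obtain ⟨Q, hQ, hHQ⟩ := (eq_top_or_exists_le_coatom H).resolve_left fun h =>
      hfixe fun g => (hH g).1 (h ▸ Subgroup.mem_top g)
    obtain ⟨y, hy, hyQ⟩ : ∃ y ∈ S, y ∉ Q.normalCore := by
      by_contra! hcon
      have := Subgroup.normalClosure_le_normal (N := Q.normalCore) hcon
      rw [hS, top_le_iff] at this
      exact hQ.1 (top_le_iff.1 (this ▸ Q.normalCore_le))
    obtain ⟨u, hu⟩ := exists_disjoint_translate hQ hyQ
    have hstab : ∀ g, endConj ρ y (endConj ρ g e) = endConj ρ g e ↔ g⁻¹ * y * g ∈ H := by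
      intro g
      rw [hH, map_mul, map_mul, map_inv, Equiv.Perm.mul_apply, Equiv.Perm.mul_apply,
        Equiv.Perm.inv_eq_iff_eq]
    refine ⟨y, hy, AddMonoid.End.card_fixed_pow_six_le Ω (Nat.card (AddMonoidHom.range e)) ?_ hidem
      horth hsum (endConj ρ y) (ρ y) ?_ (hΩconj y) (fun f _ => mul_eq_endConj_mul ρ y f) ?_⟩
    · intro f hf
      obtain ⟨g, rfl⟩ := (hmemΩ f).1 hf
      exact card_range_endConj ρ g e
    · exact Function.LeftInverse.injective (map_inv_apply_map_apply ρ y)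
    · have hdisj : (Ω.filter fun f => endConj ρ y f = f).image (endConj ρ u) ⊆
          Ω.filter fun f => ¬ endConj ρ y f = f := by
        intro f' hf'
        obtain ⟨f, hf, rfl⟩ := Finset.mem_image.1 hf'
        obtain ⟨hfΩ, hfy⟩ := Finset.mem_filter.1 hf
        refine Finset.mem_filter.2 ⟨hΩconj u f hfΩ, fun h => ?_⟩
        obtain ⟨g, rfl⟩ := (hmemΩ f).1 hfΩ
        rw [← Equiv.Perm.mul_apply (endConj ρ u), ← map_mul, hstab] at h
        exact hu g (hHQ ((hstab g).1 hfy)) (hHQ h)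
      have h1 := Finset.card_le_card hdisj
      rw [Finset.card_image_of_injective _ (endConj ρ u).injective] at h1
      have h2 := Finset.card_filter_add_card_filter_not (s := Ω) fun f => endConj ρ y f = f
      omega

theorem exists_card_fixed_le_of_injective [Finite G] [Group.IsSolvable G] [Finite V] [Nontrivial V]
    [Nontrivial G] {ρ : G →* AddMonoid.End V} (hρ : Function.Injective ρ)
    (hirr : ∀ W : AddSubgroup V, (∀ g, ∀ w ∈ W, ρ g w ∈ W) → W = ⊥ ∨ W = ⊤)
    {S : Set G} (hS : Subgroup.normalClosure S = ⊤) :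
    ∃ y ∈ S, Nat.card (ρ y).fixed ^ 6 ≤ Nat.card V ^ 5 := by
  by_cases hG : Subgroup.center G = ⊤
  · obtain ⟨y, hy, hy1⟩ : ∃ y ∈ S, y ≠ 1 := by
      by_contra! hcon
      have := Subgroup.normalClosure_le_normal (N := (⊥ : Subgroup G))
        fun y hy => Subgroup.mem_bot.2 (hcon y hy)
      rw [hS] at this
      exact bot_ne_top (top_le_iff.1 this)
    refine ⟨y, hy, ?_⟩
    rw [fixed_eq_bot_of_mem_center hρ hirr (hG ▸ Subgroup.mem_top y) hy1]
    simpa using Nat.one_le_pow _ _ (Nat.card_pos (α := V))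
  · obtain ⟨A, ⟨hA, hAc⟩, hmin⟩ := WellFounded.has_min
      (wellFounded_lt (α := Subgroup G)) {A | A.Normal ∧ ¬ A ≤ Subgroup.center G}
      ⟨⊤, inferInstance, fun h => hG (top_le_iff.1 h)⟩
    by_cases hcomm : ∀ a ∈ A, ∀ b ∈ A, ⁅a, b⁆ = 1
    · exact exists_card_fixed_le_of_comm hρ hirr hS hAc hcomm
    · refine exists_card_fixed_le_of_noncomm hρ hirr hS hAc (fun X hX hXA => ?_) hcomm
      by_contra! h
      exact hmin X ⟨hX, h.1⟩ (lt_of_le_of_ne hXA h.2)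

/-- In a nontrivial irreducible representation of a finite solvable group, some member of every
normally generating set has few fixed points. -/
theorem exists_card_fixed_le [Finite G] [Group.IsSolvable G] [Finite V] [Nontrivial V]
    {ρ : G →* AddMonoid.End V} (hρ : ρ ≠ 1)
    (hirr : ∀ W : AddSubgroup V, (∀ g, ∀ w ∈ W, ρ g w ∈ W) → W = ⊥ ∨ W = ⊤)
    {S : Set G} (hS : Subgroup.normalClosure S = ⊤) :
    ∃ y ∈ S, Nat.card (ρ y).fixed ^ 6 ≤ Nat.card V ^ 5 := by
  have : Nontrivial (G ⧸ ρ.ker) := by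
    rw [QuotientGroup.nontrivial_iff]
    exact fun h => hρ (MonoidHom.ker_eq_top_iff.1 h)
  obtain ⟨ρ', hmk⟩ : ∃ ρ' : G ⧸ ρ.ker →* AddMonoid.End V,
      ∀ g, ρ' (QuotientGroup.mk' ρ.ker g) = ρ g :=
    ⟨QuotientGroup.lift ρ.ker ρ fun g hg => hg, fun g => rfl⟩
  have hinj : Function.Injective ρ' := by
    rw [injective_iff_map_eq_one]
    intro a ha
    obtain ⟨g, rfl⟩ := QuotientGroup.mk'_surjective _ a
    rw [hmk] at ha
    exact (QuotientGroup.eq_one_iff g).2 ha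
  have hS' : Subgroup.normalClosure (QuotientGroup.mk' ρ.ker '' S) = ⊤ := by
    rw [← Subgroup.map_normalClosure _ _ (QuotientGroup.mk'_surjective _), hS,
      ← MonoidHom.range_eq_map, MonoidHom.range_eq_top]
    exact QuotientGroup.mk'_surjective _
  have hirr' : ∀ W : AddSubgroup V,
      (∀ g, ∀ w ∈ W, ρ' g w ∈ W) → W = ⊥ ∨ W = ⊤ := fun W hW =>
    hirr W fun g w hw => by
      have := hW (QuotientGroup.mk' _ g) w hw
      rwa [hmk] at this
  obtain ⟨_, ⟨y, hy, rfl⟩, h⟩ :=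
    exists_card_fixed_le_of_injective hinj hirr' hS'
  rw [hmk] at h
  exact ⟨y, hy, h⟩

end Representation

section Linear

variable {G ι : Type*} [Group G]

/-- The product of the conjugates `e i * w i * (e i)⁻¹` along a list. -/
def conjProd (l : List ι) (w e : ι → G) : G :=
  (l.map fun i => e i * w i * (e i)⁻¹).prod

theorem conjProd_nil (w e : ι → G) : conjProd [] w e = 1 := rfl

theorem conjProd_cons (i : ι) (l : List ι) (w e : ι → G) :
    conjProd (i :: l) w e = e i * w i * (e i)⁻¹ * conjProd l w e := by
  simp [conjProd]

theorem conjProd_append (l l' : List ι) (w e : ι → G) :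
    conjProd (l ++ l') w e = conjProd l w e * conjProd l' w e := by
  simp [conjProd]

theorem conjProd_congr {l : List ι} {w e w' e' : ι → G}
    (h : ∀ i ∈ l, e i * w i * (e i)⁻¹ = e' i * w' i * (e' i)⁻¹) :
    conjProd l w e = conjProd l w' e' := by
  rw [conjProd, conjProd, List.map_congr_left h]

theorem map_conjProd {H : Type*} [Group H] (f : G →* H) (l : List ι) (w e : ι → G) :
    f (conjProd l w e) = conjProd l (fun i => f (w i)) (fun i => f (e i)) := by
  simp [conjProd, map_list_prod, Function.comp_def]

theorem conjProd_mul (l : List ι) (w e e' : ι → G) :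
    conjProd l w (e' * e) = conjProd l (fun i => e i * w i * (e i)⁻¹) e' := by
  rw [conjProd, conjProd]
  congr 2
  ext i
  simp only [Pi.mul_apply]
  group

theorem conjProd_mem {H : Subgroup G} {l : List ι} {w e : ι → G}
    (h : ∀ i ∈ l, e i * w i * (e i)⁻¹ ∈ H) : conjProd l w e ∈ H := by
  refine H.list_prod_mem fun x hx => ?_
  obtain ⟨i, hi, rfl⟩ := List.mem_map.1 hx
  exact h i hi

theorem conjProd_cons_mul_inv (i : ι) (l : List ι) (w e : ι → G) :
    conjProd (i :: l) w e * (conjProd (i :: l) w 1)⁻¹ =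
      ⁅e i, w i⁆ * (w i * (conjProd l w e * (conjProd l w 1)⁻¹) * (w i)⁻¹) := by
  rw [conjProd_cons, conjProd_cons, commutatorElement_def]
  simp only [Pi.one_apply]
  group

theorem commutatorElement_mem_left {A : Subgroup G} (hA : A.Normal) {a : G} (ha : a ∈ A) (g : G) :
    ⁅a, g⁆ ∈ A :=
  Subgroup.mem_of_eq (A.mul_mem ha (hA.conj_mem _ (A.inv_mem ha) g))
    (by simp only [commutatorElement_def]; group)

theorem conjProd_mul_inv_mem {A : Subgroup G} (hA : A.Normal) (l : List ι) (w e : ι → G)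
    (he : ∀ i, e i ∈ A) : conjProd l w e * (conjProd l w 1)⁻¹ ∈ A := by
  induction l with
  | nil => simp [conjProd_nil]
  | cons i l ih =>
    rw [conjProd_cons_mul_inv]
    exact A.mul_mem (commutatorElement_mem_left hA (he i) _) (hA.conj_mem _ ih _)

theorem conjProd_mul_inv_mul {A : Subgroup G} (hA : A.Normal)
    (hcomm : ∀ a ∈ A, ∀ b ∈ A, a * b = b * a) (l : List ι) (w e e' : ι → G) (he : ∀ i, e i ∈ A)
    (he' : ∀ i, e' i ∈ A) :
    conjProd l w (e * e') * (conjProd l w 1)⁻¹ =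
      (conjProd l w e * (conjProd l w 1)⁻¹) * (conjProd l w e' * (conjProd l w 1)⁻¹) := by
  induction l with
  | nil => simp [conjProd_nil]
  | cons i l ih =>
    rw [conjProd_cons_mul_inv, conjProd_cons_mul_inv, conjProd_cons_mul_inv, ih]
    have h1 := conjProd_mul_inv_mem hA l w e he
    have h2 := commutatorElement_mem_left hA (he' i) (w i)
    generalize conjProd l w e * (conjProd l w 1)⁻¹ = x at *
    generalize conjProd l w e' * (conjProd l w 1)⁻¹ = y at *
    have h3 : ⁅(e * e') i, w i⁆ = ⁅e i, w i⁆ * ⁅e' i, w i⁆ := by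
      have := hcomm _ (hA.conj_mem _ (A.inv_mem (he i)) (w i)) _ h2
      calc ⁅(e * e') i, w i⁆ = e i * (⁅e' i, w i⁆ * (w i * (e i)⁻¹ * (w i)⁻¹)) := by
            simp only [commutatorElement_def, Pi.mul_apply]; group
        _ = _ := by rw [← this]; simp only [commutatorElement_def]; group
    have h4 := hcomm _ h2 _ (hA.conj_mem _ h1 (w i))
    rw [h3]
    calc ⁅e i, w i⁆ * ⁅e' i, w i⁆ * (w i * (x * y) * (w i)⁻¹)
        = ⁅e i, w i⁆ * (⁅e' i, w i⁆ * (w i * x * (w i)⁻¹)) * (w i * y * (w i)⁻¹) := by group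
      _ = _ := by rw [h4]; group

/-- The effect on a product of conjugating its factors by elements of an abelian normal subgroup. -/
def conjProdHom {M : Type*} [Group M] (f : M →* G) (hA : f.range.Normal)
    (hcomm : ∀ a ∈ f.range, ∀ b ∈ f.range, a * b = b * a) (l : List ι) (w : ι → G) :
    (ι → M) →* G where
  toFun e := conjProd l w (fun i => f (e i)) * (conjProd l w 1)⁻¹
  map_one' := by
    have : (fun i => f ((1 : ι → M) i)) = 1 := by ext; simp
    rw [this, mul_inv_cancel]
  map_mul' e e' := by
    rw [← conjProd_mul_inv_mul hA hcomm l w _ _ (fun i => ⟨e i, rfl⟩) (fun i => ⟨e' i, rfl⟩)]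
    congr 2
    ext i
    simp

theorem conjProdHom_apply {M : Type*} [Group M] (f : M →* G) (hA : f.range.Normal)
    (hcomm : ∀ a ∈ f.range, ∀ b ∈ f.range, a * b = b * a) (l : List ι) (w : ι → G) (e : ι → M) :
    conjProdHom f hA hcomm l w e = conjProd l w (fun i => f (e i)) * (conjProd l w 1)⁻¹ :=
  rfl

theorem commutator_le_of_forall {A I : Subgroup G} (hA : A.Normal)
    (hcomm : ∀ a ∈ A, ∀ b ∈ A, a * b = b * a) (hIA : I ≤ A) {l : List ι} {w : ι → G}
    (hl : ∀ i, i ∈ l) (hw : Subgroup.closure (Set.range w) ⊔ A = ⊤)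
    (h : ∀ l₁ i l₂, l = l₁ ++ i :: l₂ → ∀ a ∈ A,
      conjProd l₁ w 1 * ⁅a, w i⁆ * (conjProd l₁ w 1)⁻¹ ∈ I) :
    ⁅A, (⊤ : Subgroup G)⁆ ≤ I := by
  have hinvconj : ∀ g, (∀ a ∈ A, ⁅a, g⁆ ∈ I) → ∀ a ∈ A, ⁅a, g⁻¹⁆ ∈ I := fun g hg a ha =>
    Subgroup.mem_of_eq (I.inv_mem (hg _ (hA.conj_mem _ ha g⁻¹)))
      (by simp only [commutatorElement_def]; group)
  have hconj : ∀ g, (∀ a ∈ A, ⁅a, g⁆ ∈ I) → ∀ x ∈ I, g * x * g⁻¹ ∈ I := fun g hg x hx =>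
    Subgroup.mem_of_eq (I.mul_mem (I.inv_mem (hg x (hIA hx))) hx)
      (by simp only [commutatorElement_def]; group)
  let H : Subgroup G :=
    { carrier := {g | ∀ a ∈ A, ⁅a, g⁆ ∈ I}
      one_mem' := fun a _ => by simp
      mul_mem' := fun {g g'} hg hg' a ha =>
        Subgroup.mem_of_eq (I.mul_mem (hg a ha) (hconj g hg _ (hg' a ha)))
          (by simp only [commutatorElement_def]; group)
      inv_mem' := fun {g} hg => hinvconj g hg }
  have hAH : A ≤ H := fun b hb a ha => by
    rw [commutatorElement_eq_one_iff_mul_comm.2 (hcomm a ha b hb)]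
    exact I.one_mem
  have hpre : ∀ l₁ l₂, l = l₁ ++ l₂ → ∀ i ∈ l₁, w i ∈ H := by
    intro l₁
    induction l₁ using List.reverseRecOn with
    | nil => simp
    | append_singleton l₁ j ih =>
      intro l₂ hl₂ i hi
      rw [List.append_assoc, List.singleton_append] at hl₂
      have hpref := ih _ hl₂
      rcases List.mem_append.1 hi with hi | hi
      · exact hpref i hi
      · rw [List.mem_singleton.1 hi]
        intro a ha
        have hU : conjProd l₁ w 1 ∈ H := conjProd_mem fun i hi => by simpa using hpref i hi
        exact Subgroup.mem_of_eq (hconj _ (H.inv_mem hU) _ (h _ _ _ hl₂ a ha)) (by group)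
  have hH : H = ⊤ := by
    rw [← top_le_iff, ← hw, sup_le_iff, Subgroup.closure_le]
    refine ⟨?_, hAH⟩
    rintro _ ⟨i, rfl⟩
    exact hpre l [] (by simp) i (hl i)
  exact Subgroup.commutator_le.2 fun a ha g _ => (hH ▸ Subgroup.mem_top g : g ∈ H) a ha

theorem range_conjProdHom {M : Type*} [Group M] (f : M →* G) (hA : f.range.Normal)
    (hcomm : ∀ a ∈ f.range, ∀ b ∈ f.range, a * b = b * a) {l : List ι} (w : ι → G)
    (hnodup : l.Nodup) (hl : ∀ i, i ∈ l) (hw : Subgroup.closure (Set.range w) ⊔ f.range = ⊤) :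
    (conjProdHom f hA hcomm l w).range = ⁅f.range, (⊤ : Subgroup G)⁆ := by
  classical
  apply le_antisymm
  · rintro _ ⟨e, rfl⟩
    rw [conjProdHom_apply]
    clear hnodup hl
    induction l with
    | nil => simp [conjProd_nil]
    | cons i l ih =>
      rw [conjProd_cons_mul_inv]
      refine Subgroup.mul_mem _
        (Subgroup.commutator_mem_commutator ⟨_, rfl⟩ (Subgroup.mem_top _)) ?_
      have : (⁅f.range, (⊤ : Subgroup G)⁆).Normal := Subgroup.commutator_normal _ _
      exact this.conj_mem _ ih _
  · refine commutator_le_of_forall hA hcomm ?_ hl hw ?_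
    · rintro _ ⟨e, rfl⟩
      exact conjProd_mul_inv_mem hA l w _ fun i => ⟨e i, rfl⟩
    · rintro l₁ i l₂ hll _ ⟨a, rfl⟩
      refine ⟨Pi.mulSingle i a, ?_⟩
      have hne : ∀ j, j ≠ i → f ((Pi.mulSingle i a : ι → M) j) = 1 := fun j hj => by
        rw [Pi.mulSingle_eq_of_ne hj, map_one]
      rw [hll, List.nodup_middle, List.nodup_cons, List.mem_append] at hnodup
      have h1 : conjProd l₁ w (fun j => f ((Pi.mulSingle i a : ι → M) j)) = conjProd l₁ w 1 :=
        conjProd_congr fun j hj => by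
          rw [hne j fun h => hnodup.1 (Or.inl (h ▸ hj))]; rfl
      have h2 : conjProd l₂ w (fun j => f ((Pi.mulSingle i a : ι → M) j)) = conjProd l₂ w 1 :=
        conjProd_congr fun j hj => by
          rw [hne j fun h => hnodup.1 (Or.inr (h ▸ hj))]; rfl
      rw [conjProdHom_apply, hll, conjProd_append, conjProd_append, conjProd_cons, conjProd_cons,
        h1, h2, Pi.mulSingle_eq_same, commutatorElement_def]
      simp only [Pi.one_apply]
      group

end Linear

/-- A normal subgroup `M = ⁅M, G⁆` that is minimal modulo the center and abelian modulo it. -/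
structure IsChiefOverCenter {G : Type*} [Group G] (M : Subgroup G) : Prop where
  normal : M.Normal
  commutator_top : ⁅M, (⊤ : Subgroup G)⁆ = M
  commutator_le : ⁅M, M⁆ ≤ Subgroup.center G
  minimal : ∀ X : Subgroup G, X.Normal → X ≤ M → X ≤ Subgroup.center G ∨ X = M
  not_le : ¬ M ≤ Subgroup.center G

/-- The elements of `M` commuting with `g` modulo the center. -/
def Subgroup.centralizerModCenter {G : Type*} [Group G] (M : Subgroup G) (g : G) : Subgroup G :=
  M ⊓ (Subgroup.centralizer {QuotientGroup.mk' (Subgroup.center G) g}).comap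
    (QuotientGroup.mk' (Subgroup.center G))

theorem Subgroup.mem_centralizerModCenter {G : Type*} [Group G] {M : Subgroup G} {g x : G} :
    x ∈ M.centralizerModCenter g ↔ x ∈ M ∧ ⁅x, g⁆ ∈ Subgroup.center G := by
  rw [centralizerModCenter, mem_inf, mem_comap, mem_centralizer_singleton_iff,
    ← QuotientGroup.eq_one_iff (N := Subgroup.center G)]
  refine and_congr_right fun _ => ?_
  rw [← commutatorElement_eq_one_iff_mul_comm, ← map_commutatorElement]
  rfl

theorem Subgroup.card_inf_comap {G H : Type*} [Group G] [Group H] (f : G →* H) (M : Subgroup G)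
    (T : Subgroup H) :
    Nat.card (M ⊓ T.comap f : Subgroup G) =
      Nat.card (M ⊓ f.ker : Subgroup G) * Nat.card (M.map f ⊓ T : Subgroup H) := by
  let g := f.comp (M ⊓ T.comap f).subtype
  have h1 : g.range = M.map f ⊓ T := by
    ext y
    constructor
    · rintro ⟨⟨x, hx⟩, rfl⟩
      exact ⟨⟨x, hx.1, rfl⟩, hx.2⟩
    · rintro ⟨⟨x, hx, rfl⟩, hT⟩
      exact ⟨⟨x, hx, hT⟩, rfl⟩
  have h2 : g.ker.map (M ⊓ T.comap f).subtype = M ⊓ f.ker := by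
    ext y
    constructor
    · rintro ⟨⟨x, hx⟩, hk, rfl⟩
      exact ⟨hx.1, hk⟩
    · rintro ⟨hM, hk⟩
      have hk' : f y = 1 := hk
      exact ⟨⟨y, hM, by change f y ∈ T; rw [hk']; exact T.one_mem⟩, hk, rfl⟩
  rw [← h1, ← h2, Nat.card_congr (Subgroup.equivMapOfInjective g.ker (M ⊓ T.comap f).subtype
    (Subgroup.subtype_injective _)).symm.toEquiv, ← Subgroup.index_ker,
    Subgroup.card_mul_index]

theorem card_inf_centralizer_pow_six_le {Q : Type*} [Group Q] [Finite Q] [Group.IsSolvable Q]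
    {L : Subgroup Q} [hL : L.Normal] (hmin : ∀ X : Subgroup Q, X.Normal → X ≤ L → X = ⊥ ∨ X = L)
    (hLc : ¬ L ≤ Subgroup.center Q) (hcomm : ∀ a ∈ L, ∀ b ∈ L, a * b = b * a) {S : Set Q}
    (hS : Subgroup.normalClosure S = ⊤) :
    ∃ y ∈ S, Nat.card (L ⊓ Subgroup.centralizer {y} : Subgroup Q) ^ 6 ≤ Nat.card L ^ 5 := by
  let _ : CommGroup L :=
    { (inferInstance : Group L) with
      mul_comm := fun a b => Subtype.ext (hcomm a a.2 b b.2) }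
  let ρ : Q →* AddMonoid.End (Additive L) :=
    { toFun := fun g => MonoidHom.toAdditive (MulAut.conjNormal (H := L) g).toMonoidHom
      map_one' := by ext v; simp; rfl
      map_mul' := fun g h => by ext v; simp; rfl }
  have hρ : ∀ g (v : Additive L), ((ρ g v).toMul : Q) = g * v.toMul * g⁻¹ := fun g v => rfl
  have : Nontrivial (Additive L) := by
    have : Nontrivial L := (Subgroup.nontrivial_iff_ne_bot L).2 fun h => hLc (h.le.trans bot_le)
    infer_instance
  have hfix : ∀ g v, v ∈ (ρ g).fixed ↔ ((v.toMul : L) : Q) ∈ Subgroup.centralizer {g} := by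
    intro g v
    rw [AddMonoid.End.mem_fixed, Subgroup.mem_centralizer_singleton_iff,
      ← Additive.toMul.injective.eq_iff, ← Subtype.val_injective.eq_iff, hρ, mul_inv_eq_iff_eq_mul]
    exact eq_comm
  have hρ1 : ρ ≠ 1 := by
    intro h
    refine hLc fun a ha => Subgroup.mem_center_iff.2 fun g => ?_
    have h1 : Additive.ofMul (⟨a, ha⟩ : L) ∈ (ρ g).fixed := by rw [h]; rfl
    have h2 := (hfix _ _).1 h1
    rw [Subgroup.mem_centralizer_singleton_iff] at h2
    exact h2.symm
  have hirr : ∀ W : AddSubgroup (Additive L),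
      (∀ g, ∀ w ∈ W, ρ g w ∈ W) → W = ⊥ ∨ W = ⊤ := by
    intro W hW
    let X : Subgroup Q := (AddSubgroup.toSubgroup' W).map L.subtype
    have hX : ∀ v : Additive L, ((v.toMul : L) : Q) ∈ X ↔ v ∈ W := by
      intro v
      constructor
      · rintro ⟨u, hu, huv⟩
        have : u = v.toMul := Subtype.ext huv
        rw [this] at hu
        exact hu
      · exact fun h => ⟨v.toMul, h, rfl⟩
    have hXL : X ≤ L := by
      rintro _ ⟨u, _, rfl⟩
      exact u.2
    have hXn : X.Normal := by
      refine ⟨fun x hx g => ?_⟩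
      have h1 := (hX (Additive.ofMul ⟨x, hXL hx⟩)).1 hx
      exact (hX _).2 (hW g _ h1)
    rcases hmin X hXn hXL with h | h
    · left
      rw [eq_bot_iff]
      intro v hv
      have h1 := (hX v).2 hv
      rw [h, Subgroup.mem_bot] at h1
      have h2 : v.toMul = 1 := Subtype.ext h1
      exact h2
    · right
      rw [eq_top_iff]
      intro v _
      refine (hX v).1 ?_
      rw [h]
      exact v.toMul.2
  obtain ⟨y, hy, h⟩ := exists_card_fixed_le (ρ := ρ) (S := S) hρ1 hirr hS
  refine ⟨y, hy, ?_⟩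
  have h1 : Nat.card (L ⊓ Subgroup.centralizer {y} : Subgroup Q) ≤ Nat.card (ρ y).fixed :=
    Nat.card_le_card_of_injective
      (fun v => ⟨Additive.ofMul ⟨v.1, v.2.1⟩, (hfix _ _).2 v.2.2⟩) fun v w hvw =>
        Subtype.ext (congrArg (fun u : (ρ y).fixed => ((u.1.toMul : L) : Q)) hvw)
  exact (Nat.pow_le_pow_left h1 6).trans h

theorem exists_isChiefOverCenter {G : Type*} [Group G] [Finite G] [Group.IsSolvable G]
    (hG : Subgroup.center G ≠ ⊤) (hZ : Subgroup.center (G ⧸ Subgroup.center G) = ⊥) :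
    ∃ M : Subgroup G, IsChiefOverCenter M ∧ ∀ S : Set G, Subgroup.normalClosure S = ⊤ →
      ∃ y ∈ S, Nat.card (M.centralizerModCenter y) ^ 6 *
        Nat.card (M.map (QuotientGroup.mk' (Subgroup.center G))) ≤ Nat.card M ^ 6 := by
  let f := QuotientGroup.mk' (Subgroup.center G)
  have hf : Function.Surjective f := QuotientGroup.mk'_surjective _
  have hker : f.ker = Subgroup.center G := QuotientGroup.ker_mk' _
  have hmap_bot : ∀ X : Subgroup G, X.map f = ⊥ ↔ X ≤ Subgroup.center G := fun X => by
    rw [Subgroup.map_eq_bot_iff, hker]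
  have hmap_top : (⊤ : Subgroup G).map f = ⊤ := Subgroup.map_top_of_surjective f hf
  have hnt : (⊤ : Subgroup (G ⧸ Subgroup.center G)) ≠ ⊥ := by
    rw [← hmap_top, Ne, hmap_bot]
    exact fun h => hG (top_le_iff.1 h)
  obtain ⟨L, ⟨hL, hL0⟩, hmin⟩ := WellFounded.has_min
    (wellFounded_lt (α := Subgroup (G ⧸ Subgroup.center G))) {L | L.Normal ∧ L ≠ ⊥}
    ⟨⊤, inferInstance, hnt⟩
  replace hmin : ∀ X : Subgroup (G ⧸ Subgroup.center G), X.Normal → X ≤ L → X = ⊥ ∨ X = L := by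
    intro X hX hXL
    by_contra! h
    exact hmin X ⟨hX, h.1⟩ (lt_of_le_of_ne hXL h.2)
  have hLc : ¬ L ≤ Subgroup.center _ := by
    rw [hZ, le_bot_iff]
    exact hL0
  have hLL : ⁅L, L⁆ = ⊥ := (hmin _ inferInstance (Subgroup.commutator_le_left L L)).resolve_right
    (Group.IsSolvable.commutator_lt_of_ne_bot hL0).ne
  have hLcomm : ∀ a ∈ L, ∀ b ∈ L, a * b = b * a := fun a ha b hb =>
    commutatorElement_eq_one_iff_mul_comm.1
      (Subgroup.mem_bot.1 (hLL ▸ Subgroup.commutator_mem_commutator ha hb))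
  have hLT : ⁅L, (⊤ : Subgroup (G ⧸ Subgroup.center G))⁆ = L := by
    refine (hmin _ inferInstance (Subgroup.commutator_le_left L ⊤)).resolve_left fun h => hLc ?_
    rwa [Subgroup.commutator_eq_bot_iff_le_centralizer, Subgroup.coe_top,
      Subgroup.centralizer_univ] at h
  have hLf : (L.comap f).map f = L := Subgroup.map_comap_eq_self_of_surjective hf L
  let M := ⁅L.comap f, (⊤ : Subgroup G)⁆
  have hMn : M.Normal := inferInstance
  have hML : M.map f = L := by rw [Subgroup.map_commutator, hLf, hmap_top, hLT]
  have hMmin : ∀ X : Subgroup G, X.Normal → X ≤ M → X ≤ Subgroup.center G ∨ X = M := by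
    intro X hX hXM
    rcases hmin (X.map f) (hX.map f hf) (hML ▸ Subgroup.map_mono hXM) with h | h
    · exact Or.inl ((hmap_bot X).1 h)
    · refine Or.inr (le_antisymm hXM ?_)
      have h1 : L.comap f = X ⊔ Subgroup.center G := by rw [← h, Subgroup.comap_map_eq, hker]
      refine Subgroup.commutator_le.2 fun a ha g _ => ?_
      rw [h1, Subgroup.mem_sup_of_normal_right] at ha
      obtain ⟨x, hx, z, hz, rfl⟩ := ha
      have h2 : ⁅x * z, g⁆ = ⁅x, g⁆ := by
        rw [commutatorElement_def, commutatorElement_def, mul_assoc x z g,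
          ← Subgroup.mem_center_iff.1 hz g]
        group
      rw [h2]
      exact commutatorElement_mem_left hX hx g
  have hMc : ¬ M ≤ Subgroup.center G := by rw [← hmap_bot, hML]; exact hL0
  refine ⟨M, ⟨hMn, ?_, ?_, hMmin, hMc⟩, fun S hS => ?_⟩
  · refine (hMmin _ inferInstance (Subgroup.commutator_le_left M ⊤)).resolve_left fun h => ?_
    rw [← hmap_bot, Subgroup.map_commutator, hML, hmap_top, hLT] at h
    exact hL0 h
  · rw [← hmap_bot, Subgroup.map_commutator, hML, hLL]
  · have hS' : Subgroup.normalClosure (f '' S) = ⊤ := by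
      rw [← Subgroup.map_normalClosure _ _ hf, hS, hmap_top]
    obtain ⟨_, ⟨y, hy, rfl⟩, h⟩ := card_inf_centralizer_pow_six_le hmin hLc hLcomm hS'
    refine ⟨y, hy, ?_⟩
    have h1 := Subgroup.card_inf_comap f M (Subgroup.centralizer {f y})
    have h2 := Subgroup.card_inf_comap f M ⊤
    rw [Subgroup.comap_top, inf_top_eq, inf_top_eq, hML] at h2
    rw [hML] at h1
    change Nat.card (M ⊓ (Subgroup.centralizer {f y}).comap f : Subgroup G) ^ 6 *
      Nat.card (M.map f) ≤ _
    rw [hML, h1, h2, mul_pow, mul_pow]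
    calc _ ≤ Nat.card (M ⊓ f.ker : Subgroup G) ^ 6 * Nat.card L ^ 5 * Nat.card L := by gcongr
      _ = _ := by ring

namespace IsChiefOverCenter

variable {G : Type*} [Group G] {M : Subgroup G}

/-- Commutation with a fixed element, as a homomorphism. -/
def commutatorHom (hM : IsChiefOverCenter M) (v : M) : M →* G where
  toFun u := ⁅(v : G), (u : G)⁆
  map_one' := by simp
  map_mul' u u' := by
    have h1 := Subgroup.mem_center_iff.1
      (hM.commutator_le (Subgroup.commutator_mem_commutator v.2 u'.2)) u
    calc ⁅(v : G), ((u * u' : M) : G)⁆ = ⁅(v : G), (u : G)⁆ * ((u : G) * ⁅(v : G), (u' : G)⁆) *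
          (u : G)⁻¹ := by simp only [commutatorElement_def, Subgroup.coe_mul]; group
      _ = _ := by rw [h1]; group

theorem commutatorHom_apply (hM : IsChiefOverCenter M) (v u : M) :
    hM.commutatorHom v u = ⁅(v : G), (u : G)⁆ :=
  rfl

theorem range_commutatorHom (hM : IsChiefOverCenter M) {v : M}
    (hv : (v : G) ∉ Subgroup.center G) : (hM.commutatorHom v).range = ⁅M, M⁆ := by
  have := hM.normal
  have hle : (hM.commutatorHom v).range ≤ ⁅M, M⁆ := by
    rintro _ ⟨u, rfl⟩
    exact Subgroup.commutator_mem_commutator v.2 u.2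
  refine le_antisymm hle ?_
  have hJ : (hM.commutatorHom v).range.Normal := by
    refine ⟨fun c hc g => Subgroup.mem_of_eq hc ?_⟩
    rw [Subgroup.mem_center_iff.1 (hM.commutator_le (hle hc)) g]
    group
  rcases hM.minimal (M ⊓ M.centralizerMod (hM.commutatorHom v).range) inferInstance
    inf_le_left with h | h
  · refine (hv (h ⟨v.2, fun a ha => ?_⟩)).elim
    exact Subgroup.mem_of_eq (inv_mem ⟨⟨a, ha⟩, rfl⟩) (commutatorElement_inv _ _).symm
  · refine Subgroup.commutator_le.2 fun a ha b hb => ?_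
    rw [← h] at hb
    exact hb.2 a ha

theorem card_ker_commutatorHom (hM : IsChiefOverCenter M) {v : M}
    (hv : (v : G) ∉ Subgroup.center G) :
    Nat.card (hM.commutatorHom v).ker * Nat.card (⁅M, M⁆ : Subgroup G) = Nat.card M := by
  rw [← hM.range_commutatorHom hv, ← Subgroup.index_ker, Subgroup.card_mul_index]

theorem card_commutator_mul_le [Finite G] (hM : IsChiefOverCenter M) :
    Nat.card (M ⊓ Subgroup.center G : Subgroup G) * Nat.card (⁅M, M⁆ : Subgroup G) ≤
      Nat.card M := by
  obtain ⟨v, hv, hvc⟩ := SetLike.not_le_iff_exists.1 hM.not_le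
  rw [← hM.card_ker_commutatorHom (v := ⟨v, hv⟩) hvc]
  gcongr
  refine Nat.card_le_card_of_injective (fun z => ⟨⟨z.1, z.2.1⟩, ?_⟩) fun z z' h =>
    Subtype.ext (congrArg (fun u : (hM.commutatorHom ⟨v, hv⟩).ker => ((u : M) : G)) h)
  exact commutatorElement_eq_one_iff_mul_comm.2 (Subgroup.mem_center_iff.1 z.2.2 v)

end IsChiefOverCenter

/-- The projection of `M` modulo its derived subgroup, inside the ambient quotient. -/
def Subgroup.mkCommutator {G : Type*} [Group G] (M : Subgroup G) [M.Normal] :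
    M →* G ⧸ (⁅M, M⁆ : Subgroup G) :=
  (QuotientGroup.mk' ⁅M, M⁆).comp M.subtype

namespace Subgroup

variable {G ι : Type*} [Group G] (M : Subgroup G) [hM : M.Normal]

theorem range_mkCommutator : M.mkCommutator.range = M.map (QuotientGroup.mk' ⁅M, M⁆) := by
  rw [mkCommutator, MonoidHom.range_comp, Subgroup.range_subtype]

theorem normal_range_mkCommutator : M.mkCommutator.range.Normal := by
  rw [range_mkCommutator]
  exact hM.map _ (QuotientGroup.mk'_surjective _)

theorem mkCommutator_comm : ∀ a ∈ M.mkCommutator.range, ∀ b ∈ M.mkCommutator.range,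
    a * b = b * a := by
  rintro _ ⟨a, rfl⟩ _ ⟨b, rfl⟩
  rw [← commutatorElement_eq_one_iff_mul_comm, ← map_commutatorElement]
  exact (QuotientGroup.eq_one_iff _).2 (commutator_mem_commutator a.2 b.2)

/-- `conjProdHom` for conjugation by `M`, modulo the derived subgroup of `M`. -/
def conjProdHomMod (l : List ι) (w : ι → G) : (ι → M) →* G ⧸ (⁅M, M⁆ : Subgroup G) :=
  conjProdHom M.mkCommutator M.normal_range_mkCommutator M.mkCommutator_comm l
    fun i => QuotientGroup.mk' ⁅M, M⁆ (w i)

theorem conjProdHomMod_apply (l : List ι) (w : ι → G) (e : ι → M) :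
    M.conjProdHomMod l w e =
      QuotientGroup.mk' ⁅M, M⁆ (conjProd l w (fun i => e i) * (conjProd l w 1)⁻¹) := by
  have h : (1 : ι → G ⧸ (⁅M, M⁆ : Subgroup G)) =
    fun i => QuotientGroup.mk' ⁅M, M⁆ ((1 : ι → G) i) := by ext; simp
  rw [conjProdHomMod, conjProdHom_apply, map_mul, map_inv, map_conjProd, map_conjProd, ← h]
  rfl

theorem card_range_mkCommutator_mul [Finite G] :
    Nat.card M.mkCommutator.range * Nat.card (⁅M, M⁆ : Subgroup G) = Nat.card M := by
  have h := Subgroup.card_inf_comap (QuotientGroup.mk' (⁅M, M⁆ : Subgroup G)) M ⊤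
  rw [comap_top, inf_top_eq, inf_top_eq, ← range_mkCommutator, QuotientGroup.ker_mk',
    inf_eq_right.2 (commutator_le_left M M)] at h
  rw [h, mul_comm]

theorem range_conjProdHomMod (hMT : ⁅M, (⊤ : Subgroup G)⁆ = M) {l : List ι} (w : ι → G)
    (hnodup : l.Nodup) (hl : ∀ i, i ∈ l) (hw : closure (Set.range w) ⊔ M = ⊤) :
    (M.conjProdHomMod l w).range = M.mkCommutator.range := by
  have hs := QuotientGroup.mk'_surjective (⁅M, M⁆ : Subgroup G)
  rw [conjProdHomMod, range_conjProdHom _ _ _ _ hnodup hl, range_mkCommutator,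
    ← Subgroup.map_top_of_surjective _ hs, ← map_commutator, hMT]
  rw [range_mkCommutator, ← map_top_of_surjective _ hs, ← hw, map_sup, MonoidHom.map_closure,
    ← Set.range_comp]
  rfl

theorem card_ker_conjProdHomMod [Finite G] [Finite ι] (hMT : ⁅M, (⊤ : Subgroup G)⁆ = M)
    {l : List ι} (w : ι → G) (hnodup : l.Nodup) (hl : ∀ i, i ∈ l)
    (hw : closure (Set.range w) ⊔ M = ⊤) :
    Nat.card (M.conjProdHomMod l w).ker * Nat.card M =
      Nat.card (ι → M) * Nat.card (⁅M, M⁆ : Subgroup G) := by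
  rw [← Subgroup.card_mul_index (M.conjProdHomMod l w).ker, Subgroup.index_ker,
    M.range_conjProdHomMod hMT w hnodup hl hw, mul_assoc, card_range_mkCommutator_mul]

end Subgroup

theorem IsChiefOverCenter.card_le_pow {G : Type*} [Group G] [Finite G] {M : Subgroup G}
    (hM : IsChiefOverCenter M) {d : ℕ} (x : Fin d → G)
    (hx : Subgroup.closure (Set.range x) = ⊤) :
    Nat.card M ≤ Nat.card (M.map (QuotientGroup.mk' (Subgroup.center G))) ^ (d + 1) := by
  have := hM.normal
  set v := Nat.card (M.map (QuotientGroup.mk' (Subgroup.center G))) with hv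
  set z := Nat.card (M ⊓ Subgroup.center G : Subgroup G) with hz
  have hz0 : 0 < z := Nat.card_pos
  have hcard : Nat.card M = z * v := by
    have h := Subgroup.card_inf_comap (QuotientGroup.mk' (Subgroup.center G)) M ⊤
    rwa [Subgroup.comap_top, inf_top_eq, inf_top_eq, QuotientGroup.ker_mk'] at h
  have h1 : Nat.card (⁅M, M⁆ : Subgroup G) ≤ v :=
    Nat.le_of_mul_le_mul_left (hcard ▸ hM.card_commutator_mul_le) hz0
  have h2 := M.card_ker_conjProdHomMod hM.commutator_top x (List.nodup_finRange d)
    List.mem_finRange (by rw [hx, top_sup_eq])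
  have h3 : z ^ d ≤ Nat.card (M.conjProdHomMod (List.finRange d) x).ker := by
    have : z ^ d = Nat.card (Fin d → (M ⊓ Subgroup.center G : Subgroup G)) := by
      rw [Nat.card_pi, Finset.prod_const, Finset.card_univ, Fintype.card_fin]
    rw [this]
    refine Nat.card_le_card_of_injective
      (fun e => ⟨fun i => ⟨(e i).1, (e i).2.1⟩, ?_⟩) fun e e' h => funext fun i => Subtype.ext ?_
    · rw [MonoidHom.mem_ker, Subgroup.conjProdHomMod_apply]
      have : conjProd (List.finRange d) x (fun i => ((e i).1 : G)) =
          conjProd (List.finRange d) x 1 := conjProd_congr fun i _ => by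
        rw [← Subgroup.mem_center_iff.1 (e i).2.2 (x i)]
        simp
      rw [this, mul_inv_cancel, map_one]
    · exact congrArg (fun u : (M.conjProdHomMod (List.finRange d) x).ker =>
        ((u.1 i : M) : G)) h
  have h4 : Nat.card (Fin d → M) = Nat.card M ^ d := by
    rw [Nat.card_pi, Finset.prod_const, Finset.card_univ, Fintype.card_fin]
  rw [h4] at h2
  refine Nat.le_of_mul_le_mul_left ?_ (pow_pos hz0 d)
  calc z ^ d * Nat.card M ≤ Nat.card (M.conjProdHomMod (List.finRange d) x).ker * Nat.card M := by
        gcongr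
    _ = Nat.card M ^ d * Nat.card (⁅M, M⁆ : Subgroup G) := h2
    _ ≤ Nat.card M ^ d * v := by gcongr
    _ = _ := by rw [hcard]; ring

theorem List.exists_eq_append_cons_last {α : Type*} {p : α → Prop} {l : List α}
    (h : ∃ a ∈ l, p a) : ∃ l₁ a l₂, l = l₁ ++ a :: l₂ ∧ p a ∧ ∀ b ∈ l₂, ¬ p b := by
  induction l with
  | nil => simp at h
  | cons a l ih =>
    by_cases hl : ∃ b ∈ l, p b
    · obtain ⟨l₁, b, l₂, rfl, hb, hl₂⟩ := ih hl
      exact ⟨a :: l₁, b, l₂, rfl, hb, hl₂⟩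
    · push Not at hl
      obtain ⟨b, hb, hpb⟩ := h
      rcases List.mem_cons.1 hb with rfl | hb
      · exact ⟨[], b, l, rfl, hpb, hl⟩
      · exact (hl b hb hpb).elim

theorem exists_center_conjProd_mul {G ι : Type*} [Group G] (l : List ι) (w e : ι → G)
    (he : ∀ i ∈ l, ⁅e i, w i⁆ ∈ Subgroup.center G) :
    ∃ z ∈ Subgroup.center G, ∀ m : ι → G, conjProd l w (m * e) = z * conjProd l w m := by
  induction l with
  | nil => exact ⟨1, one_mem _, fun m => by simp [conjProd_nil]⟩
  | cons i l ih =>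
    obtain ⟨z, hz, h⟩ := ih fun j hj => he j (List.mem_cons_of_mem i hj)
    refine ⟨⁅e i, w i⁆ * z, mul_mem (he i List.mem_cons_self) hz, fun m => ?_⟩
    rw [conjProd_cons, conjProd_cons, h]
    have h1 := Subgroup.mem_center_iff.1 (he i List.mem_cons_self)
    have h2 := Subgroup.mem_center_iff.1 hz
    have h3 : (m * e) i * w i * ((m * e) i)⁻¹ = m i * ⁅e i, w i⁆ * (w i * (m i)⁻¹) := by
      simp only [Pi.mul_apply, commutatorElement_def]; group
    rw [h3, h1 (m i)]
    calc ⁅e i, w i⁆ * m i * (w i * (m i)⁻¹) * (z * conjProd l w m)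
        = ⁅e i, w i⁆ * (m i * w i * (m i)⁻¹ * z) * conjProd l w m := by group
      _ = _ := by rw [h2]; group

namespace IsChiefOverCenter

variable {G ι : Type*} [Group G] [Finite G] [Finite ι] {M : Subgroup G}

theorem card_conjProd_eq_mul_le (hM : IsChiefOverCenter M) {l : List ι} (hnodup : l.Nodup)
    (hl : ∀ i, i ∈ l) (w : ι → G) (e : ι → M)
    (he : ∃ i, ⁅(e i : G), w i⁆ ∉ Subgroup.center G) :
    Nat.card {m : ι → M // conjProd l w (fun i => ((m * e) i : M)) = conjProd l w fun i => m i} *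
      Nat.card (⁅M, M⁆ : Subgroup G) ≤ Nat.card (ι → M) := by
  classical
  obtain ⟨l₁, j, l₂, hll, hj, hl₂⟩ := List.exists_eq_append_cons_last
    (p := fun i => ⁅(e i : G), w i⁆ ∉ Subgroup.center G) (he.imp fun i hi => ⟨hl i, hi⟩)
  rw [hll, List.nodup_middle, List.nodup_cons, List.mem_append, not_or] at hnodup
  obtain ⟨z, hz, hz'⟩ := exists_center_conjProd_mul l₂ w (fun i => e i)
    fun i hi => not_not.1 (hl₂ i hi)
  let v : M := ⟨⁅(e j : G), w j⁆, commutatorElement_mem_left hM.normal (e j).2 _⟩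
  have hrange := hM.range_commutatorHom (v := v) hj
  choose s hs using fun c : (⁅M, M⁆ : Subgroup G) =>
    (hrange.symm ▸ c.2 : (c : G) ∈ (hM.commutatorHom v).range)
  have key : ∀ m m' : ι → M,
      conjProd l w (fun i => ((m * e) i : M)) = conjProd l w (fun i => m i) →
      conjProd l w (fun i => ((m' * e) i : M)) = conjProd l w (fun i => m' i) →
      (∀ i, i ≠ j → m i = m' i) → hM.commutatorHom v (m j) = hM.commutatorHom v (m' j) := by
    have hform : ∀ m : ι → M,
        conjProd l w (fun i => ((m * e) i : M)) = conjProd l w (fun i => m i) →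
        (m j : G) * v * (m j : G)⁻¹ = (conjProd l₁ w fun i => ((m * e) i : M))⁻¹ *
          (conjProd l₁ w fun i => m i) * z⁻¹ := by
      intro m hm
      rw [hll, conjProd_append, conjProd_append, conjProd_cons, conjProd_cons] at hm
      have h2 : conjProd l₂ w (fun i => ((m * e) i : M)) = z * conjProd l₂ w fun i => m i :=
        hz' fun i => m i
      rw [h2] at hm
      generalize conjProd l₂ w (fun i => (m i : G)) = B at hm
      generalize conjProd l₁ w (fun i => (m i : G)) = A' at hm ⊢
      generalize conjProd l₁ w (fun i => ((m * e) i : G)) = A at hm ⊢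
      have h3 : A * (m j : G) * v * (w j * (m j : G)⁻¹ * z) * B =
          A' * ((m j : G) * w j * (m j : G)⁻¹ * B) := by
        rw [← hm]
        change A * (m j : G) * ((e j : G) * w j * (e j : G)⁻¹ * (w j)⁻¹) *
          (w j * (m j : G)⁻¹ * z) * B =
          A * ((m j * e j : G) * w j * (m j * e j : G)⁻¹ * (z * B))
        group
      have h4 := Subgroup.mem_center_iff.1 hz (w j * (m j : G)⁻¹)
      rw [h4] at h3
      have h5 : A * ((m j : G) * v) * z = A' * m j := by
        have := congrArg (fun g => g * (B⁻¹ * m j * (w j)⁻¹)) h3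
        refine Eq.trans ?_ (this.trans ?_) <;> group
      have h6 : (m j : G) * v = A⁻¹ * A' * m j * z⁻¹ := by
        rw [eq_mul_inv_iff_mul_eq, mul_assoc A⁻¹, ← h5]
        group
      rw [h6, mul_assoc _ (m j : G), Subgroup.mem_center_iff.1 (inv_mem hz) (m j : G)]
      group
    intro m m' hm hm' hmm'
    have hne : ∀ i ∈ l₁, i ≠ j := fun i hi h => hnodup.1.1 (h ▸ hi)
    have h1 : conjProd l₁ w (fun i => (m i : G)) = conjProd l₁ w fun i => m' i :=
      conjProd_congr fun i hi => by rw [hmm' i (hne i hi)]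
    have h2 : conjProd l₁ w (fun i => ((m * e) i : G)) = conjProd l₁ w fun i => (m' * e) i :=
      conjProd_congr fun i hi => by rw [Pi.mul_apply, Pi.mul_apply, hmm' i (hne i hi)]
    have h3 := hform m hm
    rw [h1, h2, ← hform m' hm'] at h3
    rw [commutatorHom_apply, commutatorHom_apply]
    calc ⁅(v : G), (m j : G)⁆ = v * ((m j : G) * v * (m j : G)⁻¹)⁻¹ := by
          rw [commutatorElement_def]; group
      _ = ⁅(v : G), (m' j : G)⁆ := by rw [h3, commutatorElement_def]; group
  rw [← Nat.card_prod]
  refine Nat.card_le_card_of_injective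
    (fun p => Function.update p.1.1 j (p.1.1 j * s p.2)) ?_
  rintro ⟨⟨m, hm⟩, c⟩ ⟨⟨m', hm'⟩, c'⟩ h
  have hoff : ∀ i, i ≠ j → m i = m' i := fun i hi => by
    simpa [Function.update_of_ne hi] using congrFun h i
  have hat : m j * s c = m' j * s c' := by simpa using congrFun h j
  have h1 := congrArg (hM.commutatorHom v) hat
  rw [map_mul, map_mul, key m m' hm hm' hoff, hs, hs, mul_right_inj] at h1
  have hcc : c = c' := Subtype.ext h1
  subst hcc
  have hmm : m = m' := funext fun i => by
    by_cases hi : i = j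
    · subst hi
      exact mul_right_cancel hat
    · exact hoff i hi
  subst hmm
  rfl

theorem card_pairs_mul_le (hM : IsChiefOverCenter M) {l : List ι} (hnodup : l.Nodup)
    (hl : ∀ i, i ∈ l) (w : ι → G) (hw : Subgroup.closure (Set.range w) ⊔ M = ⊤) :
    Nat.card {p : (ι → M) × (ι → M) //
        conjProd l w (fun i => p.1 i) = conjProd l w fun i => p.2 i} * Nat.card M ≤
      Nat.card (ι → M) ^ 2 +
        Nat.card M * (Nat.card (∀ i, M.centralizerModCenter (w i)) * Nat.card (ι → M)) := by
  classical
  have := hM.normal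
  have := Fintype.ofFinite (ι → M)
  let q : (ι → M) → ℕ := fun e => Nat.card
    {m : ι → M // conjProd l w (fun i => ((m * e) i : M)) = conjProd l w fun i => m i}
  have hpairs : Nat.card {p : (ι → M) × (ι → M) //
      conjProd l w (fun i => p.1 i) = conjProd l w fun i => p.2 i} ≤ ∑ e, q e := by
    rw [← Nat.card_sigma]
    refine Nat.card_le_card_of_injective
      (fun p => ⟨p.1.2⁻¹ * p.1.1, p.1.2, by rw [mul_inv_cancel_left]; exact p.2⟩) ?_
    intro p p' h
    have h1 := congrArg Sigma.fst h
    have h2 : p.1.2 = p'.1.2 := congrArg (fun s => s.2.1) h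
    simp only [h2, mul_right_inj] at h1
    exact Subtype.ext (Prod.ext h1 h2)
  have hker : ∀ e, q e ≠ 0 → e ∈ (M.conjProdHomMod l w).ker := by
    intro e he
    obtain ⟨⟨m, hm⟩⟩ := (Nat.card_ne_zero.1 he).1
    have h1 : M.conjProdHomMod l w (m * e) = M.conjProdHomMod l w m := by
      rw [Subgroup.conjProdHomMod_apply, Subgroup.conjProdHomMod_apply, hm]
    rwa [map_mul, mul_eq_left] at h1
  have hqT : ∀ e, q e ≤ Nat.card (ι → M) := fun e =>
    Nat.card_le_card_of_injective _ Subtype.val_injective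
  set D := Nat.card (⁅M, M⁆ : Subgroup G) with hD
  set T := Nat.card (ι → M) with hT
  have hq : ∀ e, q e * D ≤ (if e ∈ (M.conjProdHomMod l w).ker then T else 0) +
      if ∀ i, (e i : G) ∈ M.centralizerModCenter (w i) then T * D else 0 := by
    intro e
    by_cases hb : ∀ i, (e i : G) ∈ M.centralizerModCenter (w i)
    · rw [if_pos hb]
      exact (Nat.mul_le_mul_right D (hqT e)).trans (Nat.le_add_left _ _)
    · by_cases h0 : q e = 0
      · rw [h0, zero_mul]
        exact Nat.zero_le _
      · rw [if_pos (hker e h0)]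
        refine le_trans (hM.card_conjProd_eq_mul_le hnodup hl w e ?_) (Nat.le_add_right _ _)
        push Not at hb
        exact hb.imp fun i hi h => hi (Subgroup.mem_centralizerModCenter.2 ⟨(e i).2, h⟩)
  have hbad : (Finset.univ.filter fun e : ι → M =>
      ∀ i, (e i : G) ∈ M.centralizerModCenter (w i)).card ≤
      Nat.card (∀ i, M.centralizerModCenter (w i)) := by
    rw [← Fintype.card_subtype, ← Nat.card_eq_fintype_card]
    exact Nat.card_le_card_of_injective
      (fun e i => ⟨(e.1 i : G), e.2 i⟩) fun e e' h => Subtype.ext (funext fun i => Subtype.ext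
        (congrArg (fun u : ∀ i, M.centralizerModCenter (w i) => (u i : G)) h))
  have hkc : (Finset.univ.filter fun e : ι → M => e ∈ (M.conjProdHomMod l w).ker).card =
      Nat.card (M.conjProdHomMod l w).ker := by
    rw [← Fintype.card_subtype, ← Nat.card_eq_fintype_card]
  have hsum := Finset.sum_le_sum fun e (_ : e ∈ (Finset.univ : Finset (ι → M))) => hq e
  rw [← Finset.sum_mul, Finset.sum_add_distrib, ← Finset.sum_filter, ← Finset.sum_filter,
    Finset.sum_const, Finset.sum_const, hkc, smul_eq_mul, smul_eq_mul] at hsum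
  have hkm := M.card_ker_conjProdHomMod hM.commutator_top w hnodup hl hw
  rw [← hD, ← hT] at hkm
  have hD0 : 0 < D := Nat.card_pos
  refine Nat.le_of_mul_le_mul_right ?_ hD0
  calc _ = _ * D * Nat.card M := by ring
    _ ≤ (Nat.card (M.conjProdHomMod l w).ker * T +
        Nat.card (∀ i, M.centralizerModCenter (w i)) * (T * D)) * Nat.card M := by
          refine Nat.mul_le_mul_right _
            ((Nat.mul_le_mul_right D hpairs).trans (hsum.trans ?_))
          gcongr
    _ = (Nat.card (M.conjProdHomMod l w).ker * Nat.card M) * T +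
        Nat.card M * (Nat.card (∀ i, M.centralizerModCenter (w i)) * T) * D := by ring
    _ = _ := by rw [hkm]; ring

end IsChiefOverCenter

theorem Subgroup.commutator_le_of_sup_center {G : Type*} [Group G] {H : Subgroup G}
    (h : H ⊔ center G = ⊤) : _root_.commutator G ≤ H := by
  rw [_root_.commutator_def, Subgroup.commutator_le]
  intro a _ b _
  obtain ⟨a', ha', z, hz, rfl⟩ := Subgroup.mem_sup_of_normal_right.1 (h ▸ mem_top a)
  obtain ⟨b', hb', y, hy, rfl⟩ := Subgroup.mem_sup_of_normal_right.1 (h ▸ mem_top b)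
  have hz' := mem_center_iff.1 hz
  have hy' := mem_center_iff.1 hy
  refine Subgroup.mem_of_eq (H.mul_mem (H.mul_mem (H.mul_mem ha' hb') (H.inv_mem ha'))
    (H.inv_mem hb')) ?_
  rw [commutatorElement_def]
  calc a' * z * (b' * y) * (a' * z)⁻¹ * (b' * y)⁻¹
      = a' * (z * (b' * y * z⁻¹)) * a'⁻¹ * (y⁻¹ * b'⁻¹) := by group
    _ = a' * b' * y * (a'⁻¹ * (y⁻¹ * b'⁻¹)) := by rw [← hz']; group
    _ = a' * b' * (y * (a'⁻¹ * y⁻¹)) * b'⁻¹ := by group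
    _ = _ := by rw [← hy']; group

namespace IsChiefOverCenter

variable {G ι : Type*} [Group G] {M : Subgroup G}

theorem card_conj_mem_le [Finite G] [Finite ι] (hM : IsChiefOverCenter M) (w : ι → G)
    {H : Subgroup G} (hH : H ⊓ M ≤ Subgroup.center G) :
    Nat.card {m : ι → M // ∀ i, (m i : G) * w i * (m i : G)⁻¹ ∈ H} ≤
      Nat.card (∀ i, M.centralizerModCenter (w i)) := by
  rcases isEmpty_or_nonempty {m : ι → M // ∀ i, (m i : G) * w i * (m i : G)⁻¹ ∈ H} with h | ⟨⟨m₀, h₀⟩⟩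
  · simp
  have key : ∀ m : {m : ι → M // ∀ i, (m i : G) * w i * (m i : G)⁻¹ ∈ H}, ∀ i,
      (((m.1 i)⁻¹ * m₀ i : M) : G) ∈ M.centralizerModCenter (w i) := by
    rintro ⟨m, hm⟩ i
    refine Subgroup.mem_centralizerModCenter.2 ⟨((m i)⁻¹ * m₀ i).2, ?_⟩
    have h1 : (m i : G) * w i * (m i : G)⁻¹ * ((m₀ i : G) * w i * (m₀ i : G)⁻¹)⁻¹ ∈ H ⊓ M := by
      refine ⟨H.mul_mem (hm i) (H.inv_mem (h₀ i)), ?_⟩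
      exact Subgroup.mem_of_eq (M.mul_mem (commutatorElement_mem_left hM.normal (m i).2 (w i))
        (M.inv_mem (commutatorElement_mem_left hM.normal (m₀ i).2 (w i))))
        (by simp only [commutatorElement_def]; group)
    have h2 := (inferInstance : (Subgroup.center G).Normal).conj_mem _ (inv_mem (hH h1))
      (m i : G)⁻¹
    refine Subgroup.mem_of_eq h2 ?_
    rw [commutatorElement_def, Subgroup.coe_mul, Subgroup.coe_inv]
    group
  refine Nat.card_le_card_of_injective (fun m i => ⟨_, key m i⟩) fun m m' h => ?_
  refine Subtype.ext (funext fun i => Subtype.ext ?_)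
  have h1 : (((m.1 i)⁻¹ * m₀ i : M) : G) = ((m'.1 i)⁻¹ * m₀ i : M) :=
    congrArg (fun u : ∀ i, M.centralizerModCenter (w i) => (u i : G)) h
  simpa using h1

theorem exists_inf_le_center_of_closure_ne_top [Finite G] (hM : IsChiefOverCenter M) {κ : Type*}
    (x : κ → G) (hx : Subgroup.closure (Set.range x) = ⊤) (w : ι → G)
    (hw : Subgroup.closure (Set.range w) ⊔ M = ⊤) {m : ι → M}
    (hm : Subgroup.closure (Set.range fun i => (m i : G) * w i * (m i : G)⁻¹) ≠ ⊤) :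
    ∃ k : κ → M,
      (Subgroup.closure (Set.range fun i => x i * k i) ⊔ (M ⊓ Subgroup.center G)) ⊓ M ≤
        Subgroup.center G ∧
      ∀ i, (m i : G) * w i * (m i : G)⁻¹ ∈
        Subgroup.closure (Set.range fun i => x i * k i) ⊔ (M ⊓ Subgroup.center G) := by
  have := hM.normal
  obtain ⟨H, hH, hle⟩ := (eq_top_or_exists_le_coatom
    (Subgroup.closure (Set.range fun i => (m i : G) * w i * (m i : G)⁻¹))).resolve_left hm
  have hmem : ∀ i, (m i : G) * w i * (m i : G)⁻¹ ∈ H := fun i =>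
    hle (Subgroup.subset_closure ⟨i, rfl⟩)
  have hHM : H ⊔ M = ⊤ := by
    refine top_le_iff.1 (hw ▸ sup_le ((Subgroup.closure_le _).2 ?_) le_sup_right)
    rintro _ ⟨i, rfl⟩
    have h1 := (le_sup_right : M ≤ H ⊔ M) (m i).2
    exact Subgroup.mem_of_eq (mul_mem (mul_mem (inv_mem h1) ((le_sup_left : H ≤ H ⊔ M) (hmem i))) h1)
      (by group)
  have hMH : ¬ M ≤ H := fun h => hH.1 (by rw [← hHM, sup_eq_left.2 h])
  have hZH : Subgroup.center G ≤ H := by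
    by_contra hZ
    have h1 : H ⊔ Subgroup.center G = ⊤ :=
      hH.2 _ (lt_of_le_of_ne le_sup_left fun h => hZ (h ▸ le_sup_right))
    refine hMH (le_trans ?_ (Subgroup.commutator_le_of_sup_center h1))
    rw [commutator_def, ← hM.commutator_top]
    exact Subgroup.commutator_mono le_top le_rfl
  have hsup : ∀ g : G, ∃ y ∈ H, ∃ u ∈ M, y * u = g := fun g =>
    Subgroup.mem_sup_of_normal_right.1 (hHM ▸ Subgroup.mem_top g)
  have hnormal : (H ⊓ M).Normal := by
    refine ⟨fun a ha g => ⟨?_, hM.normal.conj_mem _ ha.2 g⟩⟩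
    obtain ⟨y, hy, u, hu, rfl⟩ := hsup g
    have h1 : u * a * u⁻¹ ∈ H := Subgroup.mem_of_eq (H.mul_mem (hZH (hM.commutator_le
      (Subgroup.commutator_mem_commutator hu ha.2))) ha.1)
      (by simp only [commutatorElement_def]; group)
    exact Subgroup.mem_of_eq (H.mul_mem (H.mul_mem hy h1) (H.inv_mem hy)) (by group)
  have hinf : H ⊓ M ≤ Subgroup.center G :=
    (hM.minimal _ hnormal inf_le_right).resolve_right fun h => hMH (inf_eq_right.1 h)
  choose y hy u hu hyu using fun i => hsup (x i)
  refine ⟨fun i => ⟨(u i)⁻¹, M.inv_mem (hu i)⟩, ?_⟩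
  have heq : (fun i => x i * ((⟨(u i)⁻¹, M.inv_mem (hu i)⟩ : M) : G)) = y := by
    ext i
    rw [← hyu i]
    group
  simp only [heq]
  set K := Subgroup.closure (Set.range y) ⊔ (M ⊓ Subgroup.center G) with hK
  have hKH : K ≤ H := sup_le ((Subgroup.closure_le _).2 (by rintro _ ⟨i, rfl⟩; exact hy i))
    (inf_le_right.trans hZH)
  have hKM : K ⊔ M = ⊤ := by
    refine top_le_iff.1 (hx ▸ (Subgroup.closure_le _).2 ?_)
    rintro _ ⟨i, rfl⟩
    rw [← hyu i]
    exact mul_mem ((le_sup_left.trans le_sup_left : Subgroup.closure (Set.range y) ≤ K ⊔ M)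
      (Subgroup.subset_closure ⟨i, rfl⟩)) ((le_sup_right : M ≤ K ⊔ M) (hu i))
  refine ⟨(inf_le_inf_right M hKH).trans hinf, fun i => ?_⟩
  obtain ⟨a, ha, b, hb, hab⟩ := Subgroup.mem_sup_of_normal_right.1
    (hKM ▸ Subgroup.mem_top ((m i : G) * w i * (m i : G)⁻¹))
  have hbH : b ∈ H := by
    refine Subgroup.mem_of_eq (H.mul_mem (H.inv_mem (hKH ha)) (hmem i)) ?_
    rw [← hab]
    group
  rw [← hab]
  exact mul_mem ha ((le_sup_right : _ ≤ K) ⟨hb, hinf ⟨hbH, hb⟩⟩)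

theorem card_closure_ne_top_le [Finite G] [Finite ι] (hM : IsChiefOverCenter M) {d : ℕ}
    (x : Fin d → G) (hx : Subgroup.closure (Set.range x) = ⊤) (w : ι → G)
    (hw : Subgroup.closure (Set.range w) ⊔ M = ⊤) :
    Nat.card {m : ι → M //
        Subgroup.closure (Set.range fun i => (m i : G) * w i * (m i : G)⁻¹) ≠ ⊤} ≤
      Nat.card M ^ d * Nat.card (∀ i, M.centralizerModCenter (w i)) := by
  classical
  have := Fintype.ofFinite (ι → M)
  have := Fintype.ofFinite (Fin d → M)
  let K : (Fin d → M) → Subgroup G := fun k =>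
    Subgroup.closure (Set.range fun i => x i * k i) ⊔ (M ⊓ Subgroup.center G)
  let B : (Fin d → M) → Finset (ι → M) := fun k => Finset.univ.filter fun m =>
    K k ⊓ M ≤ Subgroup.center G ∧ ∀ i, (m i : G) * w i * (m i : G)⁻¹ ∈ K k
  have hB : ∀ k, (B k).card ≤ Nat.card (∀ i, M.centralizerModCenter (w i)) := by
    intro k
    by_cases hk : K k ⊓ M ≤ Subgroup.center G
    · refine le_trans (le_of_eq ?_) (hM.card_conj_mem_le w hk)
      rw [Nat.card_eq_fintype_card, Fintype.card_subtype]
      simp [B, hk]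
    · simp [B, hk]
  have hsub : (Finset.univ.filter fun m : ι → M =>
      Subgroup.closure (Set.range fun i => (m i : G) * w i * (m i : G)⁻¹) ≠ ⊤) ⊆
      Finset.univ.biUnion B := by
    intro m hm
    obtain ⟨k, hk⟩ := hM.exists_inf_le_center_of_closure_ne_top x hx w hw (Finset.mem_filter.1 hm).2
    exact Finset.mem_biUnion.2 ⟨k, Finset.mem_univ _, Finset.mem_filter.2 ⟨Finset.mem_univ _, hk⟩⟩
  rw [Nat.card_eq_fintype_card, Fintype.card_subtype]
  refine (Finset.card_le_card hsub).trans
    ((Finset.card_biUnion_le_card_mul _ _ _ fun k _ => hB k).trans (le_of_eq ?_))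
  rw [Finset.card_univ, ← Nat.card_eq_fintype_card, Nat.card_fun, Nat.card_fin]

end IsChiefOverCenter

theorem Finset.card_sq_le_card_image_mul {α β : Type*} [Finite α] [DecidableEq β] (s : Finset α)
    (f : α → β) :
    s.card ^ 2 ≤ (s.image f).card * Nat.card {p : α × α // f p.1 = f p.2} := by
  classical
  have := Fintype.ofFinite α
  have h1 : s.card = ∑ b ∈ s.image f, (s.filter fun a => f a = b).card :=
    Finset.card_eq_sum_card_fiberwise fun a ha => Finset.mem_image_of_mem f ha
  let P := (s ×ˢ s).filter fun p => f p.1 = f p.2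
  have h2 : P.card = ∑ b ∈ s.image f, (P.filter fun p => f p.1 = b).card :=
    Finset.card_eq_sum_card_fiberwise fun p hp => Finset.mem_image_of_mem f
      (Finset.mem_product.1 (Finset.mem_filter.1 hp).1).1
  have h3 : ∀ b ∈ s.image f, (s.filter fun a => f a = b).card ^ 2 ≤
      (P.filter fun p => f p.1 = b).card := by
    intro b _
    rw [sq, ← Finset.card_product]
    refine Finset.card_le_card fun p hp => ?_
    simp only [P, Finset.mem_product, Finset.mem_filter] at hp ⊢
    exact ⟨⟨⟨hp.1.1, hp.2.1⟩, hp.1.2.trans hp.2.2.symm⟩, hp.1.2⟩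
  have h4 : P.card ≤ Nat.card {p : α × α // f p.1 = f p.2} := by
    rw [Nat.card_eq_fintype_card, Fintype.card_subtype]
    exact Finset.card_le_card fun p hp =>
      Finset.mem_filter.2 ⟨Finset.mem_univ _, (Finset.mem_filter.1 hp).2⟩
  rw [h1]
  refine sq_sum_le_card_mul_sum_sq.trans (Nat.mul_le_mul_left _ ?_)
  exact (Finset.sum_le_sum h3).trans (h2 ▸ h4)

theorem not_sq_le_of_missing_value {X T P g b κ F : ℤ} (hX : 2 ≤ X) (hT : 0 < T)
    (hP : P * X ≤ T ^ 2 + X * (κ * T)) (hb : X ^ 3 * b ≤ T) (hκ : X ^ 3 * κ ≤ T)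
    (hgb : g + b = T) (hF0 : 0 ≤ F) (hF : F + 1 ≤ X) : ¬ g ^ 2 ≤ F * P := by
  intro hg
  have hX0 : 0 ≤ X := by linarith
  have hX3 : 1 ≤ X ^ 3 := one_le_pow₀ (by linarith)
  have h1 : (X ^ 3 - 1) * T ≤ X ^ 3 * g := by
    rw [← hgb] at hb ⊢
    linarith
  have h2 : ((X ^ 3 - 1) * T) ^ 2 ≤ (X ^ 3 * g) ^ 2 :=
    pow_le_pow_left₀ (mul_nonneg (by linarith) hT.le) h1 2
  have h3 : X ^ 3 * (κ * T) ≤ T * T := by nlinarith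
  have h4 : X ^ 7 * g ^ 2 ≤ (X - 1) * ((X ^ 6 + X ^ 4) * T ^ 2) := by
    calc X ^ 7 * g ^ 2 ≤ X ^ 7 * (F * P) := by gcongr
      _ = F * (X ^ 6 * (P * X)) := by ring
      _ ≤ F * (X ^ 6 * (T ^ 2 + X * (κ * T))) := by gcongr
      _ = F * (X ^ 6 * T ^ 2 + X ^ 4 * (X ^ 3 * (κ * T))) := by ring
      _ ≤ F * (X ^ 6 * T ^ 2 + X ^ 4 * (T * T)) :=
          mul_le_mul_of_nonneg_left (by gcongr) hF0
      _ = F * ((X ^ 6 + X ^ 4) * T ^ 2) := by ring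
      _ ≤ _ := mul_le_mul_of_nonneg_right (by linarith) (by positivity)
  have h5 : X * ((X ^ 3 - 1) ^ 2 - (X - 1) * (X ^ 5 + X ^ 3)) * T ^ 2 ≤ 0 := by
    nlinarith [mul_le_mul_of_nonneg_left h2 hX0]
  have h6 : 0 < (X ^ 3 - 1) ^ 2 - (X - 1) * (X ^ 5 + X ^ 3) := by
    have : 0 ≤ X ^ 3 * (X * (X - 1) - 1) := mul_nonneg (by linarith) (by nlinarith)
    nlinarith
  have h7 : 0 < X * ((X ^ 3 - 1) ^ 2 - (X - 1) * (X ^ 5 + X ^ 3)) * T ^ 2 := by positivity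
  linarith

theorem not_sq_le_of_missing_value_nat {X T P g b κ F d : ℕ} (hX : 2 ≤ X) (hT : 0 < T)
    (hP : P * X ≤ T ^ 2 + X * (κ * T)) (hb : b ≤ X ^ d * κ) (hgb : g + b = T) (hF : F + 1 ≤ X)
    (hκ : κ * X ^ (d + 3) ≤ T) : ¬ g ^ 2 ≤ F * P := by
  have hb' : X ^ 3 * b ≤ T := by
    calc X ^ 3 * b ≤ X ^ 3 * (X ^ d * κ) := Nat.mul_le_mul_left _ hb
      _ = κ * X ^ (d + 3) := by ring
      _ ≤ T := hκ
  have hκ' : X ^ 3 * κ ≤ T := by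
    calc X ^ 3 * κ = X ^ 3 * (1 * κ) := by ring
      _ ≤ X ^ 3 * (X ^ d * κ) := by gcongr; exact Nat.one_le_pow _ _ (by omega)
      _ = κ * X ^ (d + 3) := by ring
      _ ≤ T := hκ
  zify at *
  exact not_sq_le_of_missing_value hX hT hP hb' hκ' hgb (by positivity) hF

namespace IsChiefOverCenter

variable {G ι : Type*} [Group G] [Finite G] [Finite ι] {M : Subgroup G}

theorem two_le_card (hM : IsChiefOverCenter M) : 2 ≤ Nat.card M := by
  have : Nontrivial M := M.nontrivial_iff_ne_bot.2 fun h => hM.not_le (h ▸ bot_le)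
  exact Finite.one_lt_card

theorem exists_conjProd_eq_of_card_le (hM : IsChiefOverCenter M) {d : ℕ} (x : Fin d → G)
    (hx : Subgroup.closure (Set.range x) = ⊤) {l : List ι} (hnodup : l.Nodup) (hl : ∀ i, i ∈ l)
    (w : ι → G) (hw : Subgroup.closure (Set.range w) ⊔ M = ⊤) {t : G}
    (ht : conjProd l w 1 * t⁻¹ ∈ M)
    (hcard : Nat.card (∀ i, M.centralizerModCenter (w i)) * Nat.card M ^ (d + 3) ≤
      Nat.card (ι → M)) :
    ∃ m : ι → M, conjProd l w (fun i => m i) = t ∧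
      Subgroup.closure (Set.range fun i => (m i : G) * w i * (m i : G)⁻¹) = ⊤ := by
  classical
  have := hM.normal
  have := Fintype.ofFinite (ι → M)
  by_contra! hne
  let p : (ι → M) → Prop := fun m =>
    Subgroup.closure (Set.range fun i => (m i : G) * w i * (m i : G)⁻¹) = ⊤
  let s : Finset (ι → M) := Finset.univ.filter p
  let Φ : (ι → M) → G := fun m => conjProd l w fun i => m i
  have hbad := hM.card_closure_ne_top_le x hx w hw
  rw [Nat.card_eq_fintype_card, Fintype.card_subtype] at hbad
  have hsplit : s.card + (Finset.univ.filter fun m => ¬ p m).card = Nat.card (ι → M) := by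
    rw [Finset.card_filter_add_card_filter_not, Finset.card_univ, Nat.card_eq_fintype_card]
  have hF : (s.image Φ).card + 1 ≤ Nat.card M := by
    have h1 : t ∉ s.image Φ := fun h => by
      obtain ⟨m, hm, hmt⟩ := Finset.mem_image.1 h
      exact hne m hmt (Finset.mem_filter.1 hm).2
    have h2 : ∀ g ∈ insert t (s.image Φ), g * t⁻¹ ∈ M := by
      intro g hg
      rcases Finset.mem_insert.1 hg with rfl | hg
      · rw [mul_inv_cancel]
        exact M.one_mem
      · obtain ⟨m, -, rfl⟩ := Finset.mem_image.1 hg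
        exact Subgroup.mem_of_eq (M.mul_mem
          (conjProd_mul_inv_mem hM.normal l w (fun i => m i) fun i => (m i).2) ht)
          (by simp only [Φ]; group)
    rw [← Finset.card_insert_of_notMem h1, ← Fintype.card_coe, ← Nat.card_eq_fintype_card]
    exact Nat.card_le_card_of_injective (fun g => ⟨g.1 * t⁻¹, h2 g.1 g.2⟩) fun g g' h =>
      Subtype.ext (mul_right_cancel (congrArg Subtype.val h))
  exact not_sq_le_of_missing_value_nat hM.two_le_card Nat.card_pos
    (hM.card_pairs_mul_le hnodup hl w hw) hbad hsplit hF hcard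
    (s.card_sq_le_card_image_mul Φ)

end IsChiefOverCenter

theorem Subgroup.card_centralizerModCenter_conj_le {G : Type*} [Group G] [Finite G]
    {M : Subgroup G} (hM : M.Normal) (y h : G) :
    Nat.card (M.centralizerModCenter (h * y * h⁻¹)) ≤ Nat.card (M.centralizerModCenter y) := by
  refine Nat.card_le_card_of_injective (fun x => ⟨h⁻¹ * x.1 * h, ?_⟩) fun x x' hx => ?_
  · obtain ⟨h1, h2⟩ := mem_centralizerModCenter.1 x.2
    refine mem_centralizerModCenter.2 ⟨mem_of_eq (hM.conj_mem _ h1 h⁻¹) (by group), ?_⟩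
    exact mem_of_eq ((inferInstance : (center G).Normal).conj_mem _ h2 h⁻¹)
      (by simp only [commutatorElement_def]; group)
  · exact Subtype.ext (by simpa using congrArg Subtype.val hx)

theorem IsChiefOverCenter.card_centralizerModCenter_mul_le {G ι : Type*} [Group G] [Finite G]
    [Finite ι] {M : Subgroup G} (hM : IsChiefOverCenter M) {d : ℕ} (x : Fin d → G)
    (hx : Subgroup.closure (Set.range x) = ⊤) (W h : ι → G) {y : G}
    (hy : Nat.card (M.centralizerModCenter y) ^ 6 *
      Nat.card (M.map (QuotientGroup.mk' (Subgroup.center G))) ≤ Nat.card M ^ 6)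
    (hc : 6 * (d + 3) * (d + 1) ≤ Nat.card {i // W i = y}) :
    Nat.card (∀ i, M.centralizerModCenter (h i * W i * (h i)⁻¹)) * Nat.card M ^ (d + 3) ≤
      Nat.card (ι → M) := by
  classical
  have := Fintype.ofFinite ι
  set X := Nat.card M
  set v := Nat.card (M.map (QuotientGroup.mk' (Subgroup.center G)))
  have hv : 0 < v := Nat.card_pos
  have hXv : X ≤ v ^ (d + 1) := hM.card_le_pow x hx
  rw [Nat.card_eq_fintype_card, Fintype.card_subtype] at hc
  have h1 : ∀ i, Nat.card (M.centralizerModCenter (h i * W i * (h i)⁻¹)) ^ 6 *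
      (if W i = y then v else 1) ≤ X ^ 6 := by
    intro i
    split_ifs with hi
    · rw [hi]
      refine le_trans ?_ hy
      gcongr
      exact Subgroup.card_centralizerModCenter_conj_le hM.normal y (h i)
    · rw [mul_one]
      gcongr
      exact Nat.card_le_card_of_injective
        (Subgroup.inclusion (inf_le_left : M.centralizerModCenter _ ≤ M))
        (Subgroup.inclusion_injective _)
  have h2 := Finset.prod_le_prod' fun i (_ : i ∈ (Finset.univ : Finset ι)) => h1 i
  rw [Finset.prod_mul_distrib, Finset.prod_pow, Finset.prod_ite, Finset.prod_const_one, mul_one,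
    Finset.prod_const, Finset.prod_pow, ← Nat.card_pi, ← Nat.card_pi] at h2
  refine (Nat.pow_le_pow_iff_left (n := 6) (by norm_num)).1 (le_trans ?_ h2)
  rw [mul_pow]
  refine Nat.mul_le_mul_left _ ?_
  calc (X ^ (d + 3)) ^ 6 ≤ ((v ^ (d + 1)) ^ (d + 3)) ^ 6 := by gcongr
    _ = v ^ (6 * (d + 3) * (d + 1)) := by rw [← pow_mul, ← pow_mul]; congr 1; ring
    _ ≤ _ := Nat.pow_le_pow_right hv hc

/-- Every system of `d`-generated normal generators of `G` indexed by `ι`, in which each element is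
repeated often enough, can be conjugated to a system of generators with any prescribed product
compatible with the abelianization. -/
def HasGeneratingConjugates {ι : Type*} (l : List ι) (d : ℕ) (G : Type*) [Group G] : Prop :=
  ∀ (x : Fin d → G) (W : ι → G) (t : G), Subgroup.closure (Set.range x) = ⊤ →
    Subgroup.normalClosure (Set.range W) = ⊤ →
    (∀ j, 6 * (d + 3) * (d + 1) ≤ Nat.card {i // W i = W j}) →
    conjProd l W 1 * t⁻¹ ∈ commutator G →
    ∃ h : ι → G, conjProd l W h = t ∧
      Subgroup.closure (Set.range fun i => h i * W i * (h i)⁻¹) = ⊤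

section

variable {ι : Type*} {l : List ι} {d : ℕ} {G : Type*} [Group G]

theorem HasGeneratingConjugates.exists_sup_eq_top [Finite ι] {B : Subgroup G} [B.Normal]
    (hB : HasGeneratingConjugates l d (G ⧸ B)) (x : Fin d → G) (W : ι → G) (t : G)
    (hx : Subgroup.closure (Set.range x) = ⊤)
    (hW : Subgroup.normalClosure (Set.range W) = ⊤)
    (hc : ∀ j, 6 * (d + 3) * (d + 1) ≤ Nat.card {i // W i = W j})
    (ht : conjProd l W 1 * t⁻¹ ∈ commutator G) :
    ∃ h : ι → G, conjProd l W h * t⁻¹ ∈ B ∧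
      Subgroup.closure (Set.range fun i => h i * W i * (h i)⁻¹) ⊔ B = ⊤ := by
  let q := QuotientGroup.mk' B
  have hq : Function.Surjective q := QuotientGroup.mk'_surjective B
  have hq1 : (1 : ι → G ⧸ B) = fun i => q ((1 : ι → G) i) := by ext; simp [q]
  have hlift : ∀ H : Subgroup G, H.map q = ⊤ → H ⊔ B = ⊤ := fun H hH => by
    rw [← QuotientGroup.ker_mk' B, ← Subgroup.comap_map_eq, hH, Subgroup.comap_top]
  obtain ⟨h', h1, h2⟩ := hB (fun i => q (x i)) (fun i => q (W i)) (q t)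
    (by
      rw [← Subgroup.map_top_of_surjective q hq, ← hx, MonoidHom.map_closure, ← Set.range_comp]
      rfl)
    (by
      rw [← Subgroup.map_top_of_surjective q hq, ← hW, Subgroup.map_normalClosure _ _ hq,
        ← Set.range_comp]
      rfl)
    (fun j => (hc j).trans (Nat.card_le_card_of_injective
      (fun i => ⟨i.1, congrArg q i.2⟩) fun i i' hi => Subtype.ext (Subtype.mk.inj hi)))
    (by
      rw [hq1, ← map_conjProd, ← map_inv, ← map_mul]
      have h3 := Subgroup.mem_map_of_mem q ht
      rw [commutator_def, Subgroup.map_commutator] at h3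
      rw [commutator_def]
      exact Subgroup.commutator_mono le_top le_top h3)
  choose h hh using fun i => hq (h' i)
  obtain rfl : (fun i => q (h i)) = h' := funext hh
  refine ⟨h, ?_, hlift _ ?_⟩
  · rw [← QuotientGroup.eq_one_iff]
    change q _ = 1
    rw [map_mul, map_inv, map_conjProd, h1, mul_inv_cancel]
  · rw [← h2, MonoidHom.map_closure, ← Set.range_comp]
    congr 2

theorem hasGeneratingConjugates_of_center_eq_top (hZ : Subgroup.center G = ⊤) :
    HasGeneratingConjugates l d G := by
  intro x W t _ hW _ ht
  have h1 : commutator G = ⊥ :=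
    le_bot_iff.1 (Subgroup.commutator_le_of_sup_center (by rw [hZ, bot_sup_eq]))
  refine ⟨1, ?_, ?_⟩
  · rwa [h1, Subgroup.mem_bot, mul_inv_eq_one] at ht
  · have : (Subgroup.closure (Set.range W)).Normal := .of_commutator_le G (by
      rw [h1]; exact bot_le)
    rw [← top_le_iff, ← hW]
    simpa using Subgroup.normalClosure_le_normal Subgroup.subset_closure

theorem hasGeneratingConjugates_of_center_quotient_ne_bot [Finite G] [Finite ι] (hnodup : l.Nodup)
    (hl : ∀ i, i ∈ l) (hZ : Subgroup.center (G ⧸ Subgroup.center G) ≠ ⊥)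
    (ih : ∀ (B : Subgroup G) [B.Normal], B ≠ ⊥ → HasGeneratingConjugates l d (G ⧸ B)) :
    HasGeneratingConjugates l d G := by
  intro x W t hx hW hc ht
  obtain ⟨a', ha'⟩ := Subgroup.ne_bot_iff_exists_ne_one.1 hZ
  obtain ⟨a, ha⟩ := QuotientGroup.mk'_surjective (Subgroup.center G) a'
  have haZ : a ∉ Subgroup.center G := fun h => ha' (Subtype.ext (by
    rw [← ha]
    exact (QuotientGroup.eq_one_iff a).2 h))
  let Z₂ := (Subgroup.center (G ⧸ Subgroup.center G)).comap (QuotientGroup.mk' (Subgroup.center G))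
  have hZ₂ : ∀ y ∈ Z₂, ∀ g, ⁅y, g⁆ ∈ Subgroup.center G := fun y hy g => by
    rw [← QuotientGroup.eq_one_iff]
    change QuotientGroup.mk' _ _ = _
    rw [map_commutatorElement, commutatorElement_eq_one_iff_mul_comm]
    exact (Subgroup.mem_center_iff.1 hy _).symm
  let A := Subgroup.zpowers a ⊔ Subgroup.center G
  have haA : a ∈ A := le_sup_left (a := Subgroup.zpowers a) (Subgroup.mem_zpowers a)
  have hZA : Subgroup.center G ≤ A := le_sup_right
  have hAZ₂ : A ≤ Z₂ := by
    refine sup_le (Subgroup.zpowers_le.2 (Subgroup.mem_comap.2 (ha ▸ a'.2))) ?_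
    nth_rw 1 [← QuotientGroup.ker_mk' (Subgroup.center G)]
    exact Subgroup.ker_le_comap _ _
  have hA : A.Normal := ⟨fun y hy g => Subgroup.mem_of_eq
    (mul_mem (hZA (inv_mem (hZ₂ y (hAZ₂ hy) g))) hy) (by simp only [commutatorElement_def]; group)⟩
  have hcomm : ∀ y ∈ A, ∀ y' ∈ A, y * y' = y' * y := by
    intro y hy y' hy'
    obtain ⟨_, ⟨n, rfl⟩, z, hz, rfl⟩ := Subgroup.mem_sup_of_normal_right.1 hy
    obtain ⟨_, ⟨k, rfl⟩, z', hz', rfl⟩ := Subgroup.mem_sup_of_normal_right.1 hy'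
    have h1 : ∀ g, Commute z g := fun g => (Subgroup.mem_center_iff.1 hz g).symm
    have h2 : ∀ g, Commute g z' := fun g => Subgroup.mem_center_iff.1 hz' g
    exact Commute.mul_left (((Commute.refl a).zpow_zpow n k).mul_right (h2 _)) (h1 _)
  let B := ⁅A, (⊤ : Subgroup G)⁆
  have hBZ : B ≤ Subgroup.center G :=
    Subgroup.commutator_le.2 fun y hy g _ => hZ₂ y (hAZ₂ hy) g
  have hB : B ≠ ⊥ := fun h => haZ (Subgroup.mem_center_iff.2 fun g =>
    (commutatorElement_eq_one_iff_mul_comm.1 (Subgroup.mem_bot.1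
      (h ▸ Subgroup.commutator_mem_commutator haA (Subgroup.mem_top g)))).symm)
  have hBcomm : B ≤ commutator G := Subgroup.commutator_mono le_top le_rfl
  have hgen : ∀ H : Subgroup G, H ⊔ B = ⊤ → H = ⊤ := fun H hH => by
    have h1 : commutator G ≤ H := Subgroup.commutator_le_of_sup_center
      (top_le_iff.1 (hH ▸ sup_le_sup_left hBZ H))
    rw [← hH, sup_eq_left.2 (hBcomm.trans h1)]
  obtain ⟨h, h1, h2⟩ := (ih B hB).exists_sup_eq_top x W t hx hW hc ht
  set w : ι → G := fun i => h i * W i * (h i)⁻¹ with hw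
  have hf : A.subtype.range = A := A.range_subtype
  have hrange := range_conjProdHom A.subtype (hf.symm ▸ hA) (hf.symm ▸ hcomm) w hnodup hl
    (by rw [hgen _ h2, top_sup_eq])
  have h3 : conjProd l w 1 = conjProd l W h := by rw [← conjProd_mul, one_mul]
  have h4 : t * (conjProd l w 1)⁻¹ ∈ ⁅A.subtype.range, (⊤ : Subgroup G)⁆ := by
    rw [hf, h3]
    exact Subgroup.mem_of_eq (inv_mem h1) (by group)
  rw [← hrange] at h4
  obtain ⟨e, he⟩ := h4
  rw [conjProdHom_apply, mul_left_inj] at he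
  refine ⟨(fun i => (e i : G)) * h, by rw [conjProd_mul]; exact he, hgen _ ?_⟩
  rw [← top_le_iff, ← hgen _ h2, Subgroup.closure_le]
  rintro _ ⟨i, rfl⟩
  have h5 : ((fun i => (e i : G)) * h) i * W i * (((fun i => (e i : G)) * h) i)⁻¹ ∈
      Subgroup.closure (Set.range fun i => ((fun i => (e i : G)) * h) i * W i *
        (((fun i => (e i : G)) * h) i)⁻¹) := Subgroup.subset_closure ⟨i, rfl⟩
  have h6 : ⁅(e i : G), w i⁆ ∈ B :=
    Subgroup.commutator_mem_commutator (e i).2 (Subgroup.mem_top _)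
  refine Subgroup.mem_of_eq (mul_mem (le_sup_right (b := B) (inv_mem h6))
    (le_sup_left (b := B) h5)) ?_
  simp only [commutatorElement_def, Pi.mul_apply, hw]
  group

theorem hasGeneratingConjugates_of_center_quotient_eq_bot [Finite G] [Group.IsSolvable G]
    [Finite ι] (hnodup : l.Nodup) (hl : ∀ i, i ∈ l) (hG : Subgroup.center G ≠ ⊤)
    (hZ : Subgroup.center (G ⧸ Subgroup.center G) = ⊥)
    (ih : ∀ (B : Subgroup G) [B.Normal], B ≠ ⊥ → HasGeneratingConjugates l d (G ⧸ B)) :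
    HasGeneratingConjugates l d G := by
  intro x W t hx hW hc ht
  obtain ⟨M, hM, hMS⟩ := exists_isChiefOverCenter hG hZ
  have := hM.normal
  obtain ⟨_, ⟨j, rfl⟩, hj⟩ := hMS (Set.range W) hW
  obtain ⟨h, h1, h2⟩ := (ih M fun h => hM.not_le (h ▸ bot_le)).exists_sup_eq_top x W t hx hW hc ht
  have h3 : conjProd l (fun i => h i * W i * (h i)⁻¹) 1 = conjProd l W h := by
    rw [← conjProd_mul, one_mul]
  obtain ⟨m, h4, h5⟩ := hM.exists_conjProd_eq_of_card_le x hx hnodup hl _ h2 (h3.symm ▸ h1)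
    (hM.card_centralizerModCenter_mul_le x hx W h hj (hc j))
  refine ⟨(fun i => (m i : G)) * h, by rw [conjProd_mul, h4], ?_⟩
  rw [← h5]
  congr 2
  ext i
  simp [mul_assoc]

end

theorem hasGeneratingConjugates {ι : Type*} [Finite ι] {l : List ι} (hnodup : l.Nodup)
    (hl : ∀ i, i ∈ l) (d : ℕ) (G : Type*) [Group G] [Finite G] [Group.IsSolvable G] :
    HasGeneratingConjugates l d G := by
  induction hn : Nat.card G using Nat.strong_induction_on generalizing G with
  | _ n ih =>
    subst hn
    have ih' : ∀ (B : Subgroup G) [B.Normal], B ≠ ⊥ → HasGeneratingConjugates l d (G ⧸ B) := by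
      intro B _ hB
      have : Group.IsSolvable (G ⧸ B) :=
        Group.isSolvable_of_surjective (QuotientGroup.mk'_surjective B)
      refine ih _ ?_ (G ⧸ B) rfl
      have h1 := B.card_eq_card_quotient_mul_card_subgroup
      have h2 : 1 < Nat.card B := B.one_lt_card_iff_ne_bot.2 hB
      have h3 : 0 < Nat.card (G ⧸ B) := Nat.card_pos
      nlinarith
    by_cases hG : Subgroup.center G = ⊤
    · exact hasGeneratingConjugates_of_center_eq_top hG
    by_cases hZ : Subgroup.center (G ⧸ Subgroup.center G) = ⊥
    · exact hasGeneratingConjugates_of_center_quotient_eq_bot hnodup hl hG hZ ih'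
    · exact hasGeneratingConjugates_of_center_quotient_ne_bot hnodup hl hZ ih'

theorem Subgroup.eq_top_of_sup_commutator_eq_top {G : Type*} [Group G] [Group.IsSolvable G]
    {K : Subgroup G} [K.Normal] (h : K ⊔ _root_.commutator G = ⊤) : K = ⊤ := by
  by_contra hK
  have : Nontrivial (G ⧸ K) := QuotientGroup.nontrivial_iff.2 hK
  have : Group.IsSolvable (G ⧸ K) :=
    Group.isSolvable_of_surjective (QuotientGroup.mk'_surjective K)
  refine (Group.IsSolvable.commutator_lt_top_of_nontrivial (G ⧸ K)).ne (top_le_iff.1 ?_)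
  have hs := QuotientGroup.mk'_surjective K
  rw [← map_top_of_surjective _ hs, ← h, map_sup, (map_eq_bot_iff _).2 (QuotientGroup.ker_mk' K).ge,
    bot_sup_eq, _root_.commutator_def, map_commutator]
  exact commutator_mono le_top le_top

namespace IsBiInvMetric

variable {G : Type*} [Group G] {d : G → G → ℝ}

theorem self (hd : IsBiInvMetric d) (g : G) : d g g = 0 := (hd.1 g g).2 rfl

theorem comm (hd : IsBiInvMetric d) (g h : G) : d g h = d h g := hd.2.1 g h

theorem triangle (hd : IsBiInvMetric d) (g h k : G) : d g k ≤ d g h + d h k := hd.2.2.1 g h k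

theorem mul_left (hd : IsBiInvMetric d) (g h k : G) : d (g * h) (g * k) = d h k :=
  hd.2.2.2.1 g h k

theorem mul_right (hd : IsBiInvMetric d) (g h k : G) : d (h * g) (k * g) = d h k :=
  hd.2.2.2.2 g h k

theorem mul_mul_le (hd : IsBiInvMetric d) (a b a' b' : G) :
    d (a * b) (a' * b') ≤ d a a' + d b b' := by
  rw [← hd.mul_right b a a', ← hd.mul_left a' b b']
  exact hd.triangle _ _ _

theorem one_mul_le (hd : IsBiInvMetric d) (a b : G) : d 1 (a * b) ≤ d 1 a + d 1 b := by
  simpa using hd.mul_mul_le 1 1 a b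

theorem one_inv (hd : IsBiInvMetric d) (a : G) : d 1 a⁻¹ = d 1 a := by
  rw [← hd.mul_left a, mul_one, mul_inv_cancel, hd.comm]

theorem one_conj (hd : IsBiInvMetric d) (a g : G) : d 1 (g * a * g⁻¹) = d 1 a := by
  rw [← hd.mul_right g, inv_mul_cancel_right, one_mul]
  simpa using hd.mul_left g 1 a

theorem one_conjProd_le (hd : IsBiInvMetric d) {ι : Type*} (l : List ι) (w e : ι → G) {η : ℝ}
    (hw : ∀ i, d 1 (w i) ≤ η) : d 1 (conjProd l w e) ≤ l.length * η := by
  induction l with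
  | nil => simp [conjProd_nil, hd.self]
  | cons i l ih =>
    rw [conjProd_cons, List.length_cons]
    push_cast
    have h1 := hd.one_mul_le (e i * w i * (e i)⁻¹) (conjProd l w e)
    rw [hd.one_conj] at h1
    linarith [hw i]

end IsBiInvMetric

/-- An almost multiplicative map approximately commutes with evaluating a given word. -/
theorem exists_dist_lift_lt {Γ α : Type*} [Group Γ] (g : α → Γ) (u : FreeGroup α) :
    ∀ η : ℝ, 0 < η → ∃ (S : Finset Γ) (ε : ℝ), 0 < ε ∧
      ∀ (G : Type) [Group G] (d : G → G → ℝ) (φ : Γ → G), IsBiInvMetric d →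
        (∀ a b : Γ, a ∈ S → b ∈ S → a * b ∈ S → d (φ a * φ b) (φ (a * b)) < ε) →
        d (FreeGroup.lift (fun i => φ (g i)) u) (φ (FreeGroup.lift g u)) < η := by
  classical
  have hone : ∀ {G : Type} [Group G] {d : G → G → ℝ} {φ : Γ → G} {S : Finset Γ} {ε : ℝ},
      IsBiInvMetric d →
      (∀ a b : Γ, a ∈ S → b ∈ S → a * b ∈ S → d (φ a * φ b) (φ (a * b)) < ε) →
      1 ∈ S → d 1 (φ 1) < ε := by
    intro G _ d φ S ε hd hS h1
    have h2 := hS 1 1 h1 h1 (by rwa [one_mul])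
    have h3 := hd.mul_left (φ 1) 1 (φ 1)
    rw [mul_one] at h3
    rwa [one_mul, hd.comm, h3] at h2
  induction u using FreeGroup.induction_on with
  | C1 =>
    intro η hη
    refine ⟨{1}, η, hη, fun G _ d φ hd hS => ?_⟩
    rw [map_one, map_one]
    exact hone hd hS (Finset.mem_singleton_self 1)
  | of i =>
    intro η hη
    refine ⟨∅, 1, one_pos, fun G _ d φ hd _ => ?_⟩
    rwa [FreeGroup.lift_apply_of, FreeGroup.lift_apply_of, hd.self]
  | inv_of i _ =>
    intro η hη
    refine ⟨{1, g i, (g i)⁻¹}, η / 2, by positivity, fun G _ d φ hd hS => ?_⟩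
    rw [map_inv, map_inv, FreeGroup.lift_apply_of, FreeGroup.lift_apply_of]
    have h1 := hone hd hS (by simp)
    have h2 := hS (g i) (g i)⁻¹ (by simp) (by simp) (by simp)
    rw [mul_inv_cancel] at h2
    rw [← hd.mul_left (φ (g i)), mul_inv_cancel]
    have h3 := hd.triangle 1 (φ 1) (φ (g i) * φ (g i)⁻¹)
    rw [hd.comm (φ 1)] at h3
    linarith
  | mul u v hu hv =>
    intro η hη
    obtain ⟨S, ε, hε, h1⟩ := hu (η / 3) (by positivity)
    obtain ⟨S', ε', hε', h2⟩ := hv (η / 3) (by positivity)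
    refine ⟨S ∪ S' ∪ {FreeGroup.lift g u, FreeGroup.lift g v, FreeGroup.lift g u * FreeGroup.lift g v},
      min (min ε ε') (η / 3), by positivity, fun G _ d φ hd hS => ?_⟩
    have h1' := h1 G d φ hd fun a b ha hb hab => lt_of_lt_of_le
      (hS a b (by simp [ha]) (by simp [hb]) (by simp [hab])) ((min_le_left _ _).trans (min_le_left _ _))
    have h2' := h2 G d φ hd fun a b ha hb hab => lt_of_lt_of_le
      (hS a b (by simp [ha]) (by simp [hb]) (by simp [hab])) ((min_le_left _ _).trans (min_le_right _ _))
    have h3 := lt_of_lt_of_le (hS (FreeGroup.lift g u) (FreeGroup.lift g v) (by simp) (by simp)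
      (by simp)) (min_le_right _ _)
    rw [map_mul, map_mul]
    refine lt_of_le_of_lt (hd.triangle _ _ _) (lt_of_lt_of_le (add_lt_add_of_le_of_lt
      ((hd.mul_mul_le _ _ _ _).trans (add_le_add h1'.le h2'.le)) h3) ?_)
    linarith

/-- In a finite solvable group, a coordinate of a generating system that almost lies in the derived
subgroup is short. -/
theorem IsBiInvMetric.one_le_of_commutator {n : ℕ} {H : Type*} [Group H] [Finite H]
    [Group.IsSolvable H] {d : H → H → ℝ} (hd : IsBiInvMetric d) (x c : Fin n → H)
    (hx : Subgroup.closure (Set.range x) = ⊤) (hc : ∀ i, c i ∈ commutator H) {η : ℝ}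
    (hη : ∀ i, d (c i) (x i) ≤ η) (i : Fin n) :
    d 1 (x i) ≤ (2 * (n * (6 * (n + 3) * (n + 1)) : ℕ) + 1) * η := by
  let ι := Fin n × Fin (6 * (n + 3) * (n + 1))
  let y : Fin n → H := fun i => (c i)⁻¹ * x i
  have hy : ∀ i, d 1 (y i) ≤ η := fun i => by
    rw [← hd.mul_left (c i), mul_one, mul_inv_cancel_left]
    exact hη i
  let W : ι → H := fun p => y p.1
  let l : List ι := Finset.univ.toList
  have hl : (l.length : ℝ) = (n * (6 * (n + 3) * (n + 1)) : ℕ) := by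
    rw [Finset.length_toList, Finset.card_univ, Fintype.card_prod, Fintype.card_fin,
      Fintype.card_fin]
  have hk : ∀ j : ι, 6 * (n + 3) * (n + 1) ≤ Nat.card {p // W p = W j} := fun j => by
    conv_lhs => rw [← Nat.card_fin (6 * (n + 3) * (n + 1))]
    exact Nat.card_le_card_of_injective (fun k => ⟨(j.1, k), rfl⟩)
      fun k k' h => congrArg (fun p : {p // W p = W j} => p.1.2) h
  have hW : Subgroup.normalClosure (Set.range W) = ⊤ := by
    refine Subgroup.eq_top_of_sup_commutator_eq_top (top_le_iff.1 ?_)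
    rw [← hx, Subgroup.closure_le]
    rintro _ ⟨j, rfl⟩
    have hpos : 0 < 6 * (n + 3) * (n + 1) := by positivity
    refine Subgroup.mem_of_eq (mul_mem (le_sup_right (a := Subgroup.normalClosure (Set.range W))
      (hc j)) (le_sup_left (b := commutator H)
        (Subgroup.subset_normalClosure ⟨(j, ⟨0, hpos⟩), rfl⟩))) ?_
    simp only [W, y, mul_inv_cancel_left]
  obtain ⟨h, h1, -⟩ := hasGeneratingConjugates (l := l) (Finset.nodup_toList _) (by simp [l]) n H x W
    (c i * conjProd l W 1) hx hW hk (Subgroup.mem_of_eq (inv_mem (hc i)) (by group))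
  have h2 : x i = conjProd l W h * (conjProd l W 1)⁻¹ * y i := by
    rw [h1]
    simp only [y]
    group
  have h3 := hd.one_conjProd_le l W h fun p => hy p.1
  have h4 := hd.one_conjProd_le l W 1 fun p => hy p.1
  rw [← hd.one_inv] at h4
  rw [hl] at h3 h4
  rw [h2]
  linarith [hd.one_mul_le (conjProd l W h * (conjProd l W 1)⁻¹) (y i),
    hd.one_mul_le (conjProd l W h) (conjProd l W 1)⁻¹, hy i]

/-- Every non-trivial finitely generated Sol-approximated group has a non-trivial
abelian quotient, i.e. its commutator subgroup is proper. -/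
theorem fg_sol_approximated_commutator_ne_top
    (Γ : Type*) [Group Γ] [Group.FG Γ] [Nontrivial Γ]
    (h : IsSolApproximated Γ) : commutator Γ ≠ ⊤ := by
  classical
  intro hΓ
  obtain ⟨s, hs, hfin⟩ := Group.fg_iff.1 ‹Group.FG Γ›
  obtain ⟨n, g, rfl⟩ : ∃ (n : ℕ) (g : Fin n → Γ), Set.range g = s := by
    have := hfin.fintype
    let e := (Fintype.equivFin s).symm
    exact ⟨_, fun i => e i, by
      rw [show (fun i => (e i : Γ)) = Subtype.val ∘ e from rfl, e.surjective.range_comp,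
        Subtype.range_coe]⟩
  let π := FreeGroup.lift g
  have hπ : Function.Surjective π := by
    rw [← MonoidHom.range_eq_top, FreeGroup.range_lift_eq_closure, hs]
  obtain ⟨i₀, hi₀⟩ : ∃ i, g i ≠ 1 := by
    by_contra! hg
    have h1 : (⊤ : Subgroup Γ) = ⊥ := by
      rw [← hs, Subgroup.closure_eq_bot_iff]
      rintro _ ⟨i, rfl⟩
      exact hg i
    exact top_ne_bot h1
  have hcomm : (commutator (FreeGroup (Fin n))).map π = ⊤ := by
    rw [commutator_def, Subgroup.map_commutator, Subgroup.map_top_of_surjective π hπ,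
      ← commutator_def, hΓ]
  choose c hc hcg using fun i => Subgroup.mem_map.1 (hcomm ▸ Subgroup.mem_top (g i))
  obtain ⟨δ, -, hδ, happrox⟩ := h
  set N : ℝ := ((n * (6 * (n + 3) * (n + 1)) : ℕ) : ℝ) with hN
  have hN0 : 0 ≤ N := Nat.cast_nonneg _
  set η : ℝ := δ (g i₀) / (2 * N + 2) with hη
  have hη0 : 0 < η := div_pos (hδ _ hi₀) (by positivity)
  choose S ε hε hSε using fun i => exists_dist_lift_lt g (c i) η hη0
  have hne : (Finset.univ : Finset (Fin n)).Nonempty := ⟨i₀, Finset.mem_univ _⟩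
  obtain ⟨G, _, _, hG, d, φ, hd, hmul, hδφ⟩ := happrox (insert (g i₀) (Finset.univ.biUnion S))
    (Finset.univ.inf' hne ε) ((Finset.lt_inf'_iff hne).2 fun i _ => hε i)
  have : Group.IsSolvable G := hG
  have hmem : ∀ i, ∀ a ∈ S i, a ∈ insert (g i₀) (Finset.univ.biUnion S) := fun i a ha =>
    Finset.mem_insert_of_mem (Finset.mem_biUnion.2 ⟨i, Finset.mem_univ _, ha⟩)
  let ψ := FreeGroup.lift fun i => φ (g i)
  have hψ : ∀ i, d (ψ (c i)) (φ (g i)) < η := fun i => by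
    have h1 := hSε i G d φ hd fun a b ha hb hab => (hmul a b (hmem i a ha) (hmem i b hb)
      (hmem i _ hab)).trans_le (Finset.inf'_le ε (Finset.mem_univ i))
    rwa [hcg] at h1
  let x : Fin n → ψ.range := fun i => ψ.rangeRestrict (FreeGroup.of i)
  have hxφ : ∀ i, (x i : G) = φ (g i) := fun i => FreeGroup.lift_apply_of
  have hd' : IsBiInvMetric fun a b : ψ.range => d a b :=
    ⟨fun a b => (hd.1 a b).trans Subtype.ext_iff.symm, fun a b => hd.comm a b,
      fun a b c => hd.triangle a b c, fun a b c => hd.mul_left a b c,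
      fun a b c => hd.mul_right a b c⟩
  have hx : Subgroup.closure (Set.range x) = ⊤ := by
    rw [← Subgroup.map_top_of_surjective _ ψ.rangeRestrict_surjective,
      ← FreeGroup.closure_range_of, MonoidHom.map_closure, ← Set.range_comp]
    rfl
  have hcψ : ∀ i, ψ.rangeRestrict (c i) ∈ commutator ψ.range := fun i => by
    have h1 := Subgroup.mem_map_of_mem ψ.rangeRestrict (hc i)
    rw [commutator_def, Subgroup.map_commutator] at h1
    exact Subgroup.commutator_mono le_top le_top h1
  have hle := hd'.one_le_of_commutator x _ hx hcψ (η := η) (fun i => by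
    rw [hxφ]
    exact (hψ i).le) i₀
  have hge := hδφ (g i₀) (Finset.mem_insert_self _ _)
  rw [hxφ, ← hN] at hle
  have h1 : δ (g i₀) = (2 * N + 2) * η := by
    rw [hη]
    field_simp
  have h2 : d 1 (φ (g i₀)) ≤ (2 * N + 1) * η := hle
  linarith
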